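/- Let w ∈ S_n and let P₀, P₁, P₂ ∈ PD(w) be distinct with P₁ = C_{i₁,j₁}(P₀) and P₂ = C_{i₂,j₂}(P₀), where the rectangles R₁ = R(P₀,P₁) and R₂ = R(P₀,P₂) satisfy: SW(R₁) is not a corner of R₂ and SW(R₂) is not a corner of R₁. Then the chute moves commute: C_{i₁,j₁} can be applied to P₂ and C_{i₂,j₂} to P₁, C_{i₁,j₁}(P₂) = C_{i₂,j₂}(P₁), this common pipe dream is the least upper bound P₁ ∨ P₂ in PD(w), Φ(P₁ ∨ P₂) is the componentwise maximum of Φ(P₁) and Φ(P₂), and the interval [P₀, P₁ ∨ P₂] is a diamond. -/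

import Mathlib

open Classical

noncomputable section

/-- 1-based value of a permutation of `Fin n` at a 1-based position `j`. -/
def permVal {n : ℕ} (w : Equiv.Perm (Fin n)) (j : ℕ) : ℕ :=
  if h : 1 ≤ j ∧ j ≤ n then (w ⟨j - 1, by omega⟩ : ℕ) + 1 else 0

/-- `(i,j)` is an inversion of `w`: `1 ≤ i < j ≤ n` and the (1-based) position of the
value `j` in the one-line notation of `w` precedes that of `i`. -/
def IsInv {n : ℕ} (w : Equiv.Perm (Fin n)) (i j : ℕ) : Prop :=
  1 ≤ i ∧ i < j ∧ j ≤ n ∧ permVal w.symm j < permVal w.symm i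

/-- Lehmer form entry at box `(i,j)`: the number of `k ∈ [1, T(i,j)-1]` that do not
appear below box `(i,j)` in column `j`. -/
def lehmer (T : ℕ → ℕ → ℕ) (i j : ℕ) : ℕ :=
  ((Finset.Ico 1 (T i j)).filter fun k => ∀ i', 1 ≤ i' → i' < i → T i' j ≠ k).card

/-- Incrementing box `(i,j)` of `T` yields `T'`:  with `a = T(i,j)` and `b` the smallest
integer greater than `a` not appearing below `(i,j)` in column `j`, either a pure
increment (if `b` is absent from column `j`) or a trade increment (swap `a` and `b`). -/
def IncrementAt (T T' : ℕ → ℕ → ℕ) (i j : ℕ) : Prop :=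
  ∃ b, T i j < b ∧
    (∀ k, T i j < k → k < b → ∃ i', 1 ≤ i' ∧ i' < i ∧ T i' j = k) ∧
    (∀ i', 1 ≤ i' → i' < i → T i' j ≠ b) ∧
    (((∀ i', 1 ≤ i' → T i' j ≠ b) ∧
        T' = fun a c => if a = i ∧ c = j then b else T a c) ∨
      (∃ i'', i < i'' ∧ T i'' j = b ∧
        T' = fun a c =>
          if a = i ∧ c = j then b else if a = i'' ∧ c = j then T i j else T a c))

/-- `IncBy M T T'`: `T'` is obtained from `T` by incrementing each box of the
multiset `M` (with multiplicity). -/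
inductive IncBy : Multiset (ℕ × ℕ) → (ℕ → ℕ → ℕ) → (ℕ → ℕ → ℕ) → Prop
  | nil (T : ℕ → ℕ → ℕ) : IncBy 0 T T
  | cons {M : Multiset (ℕ × ℕ)} {T T' T'' : ℕ → ℕ → ℕ} {i j : ℕ} :
      IncrementAt T T' i j → IncBy M T' T'' → IncBy ((i, j) ::ₘ M) T T''

/-- Column-injective tableau for `w`: a box has a nonzero entry iff it is an inversion
of `w`, and the nonzero entries in each column are distinct. -/
def ColInj {n : ℕ} (w : Equiv.Perm (Fin n)) (T : ℕ → ℕ → ℕ) : Prop :=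
  (∀ i j, T i j ≠ 0 ↔ IsInv w i j) ∧
  ∀ i i' j, 1 ≤ i → i < i' → i' < j → T i j ≠ 0 → T i' j ≠ 0 → T i j ≠ T i' j

/-- The Λ-shape `Λ(i,j,k)` is balanced in `T`. -/
def LBal (T : ℕ → ℕ → ℕ) (i j k : ℕ) : Prop :=
  min (T i j) (T j k) ≤ T i k ∧ T i k ≤ max (T i j) (T j k)

/-- Every Λ-shape of `Δ_{n-1}` is balanced in `T`. -/
def BalancedTab (n : ℕ) (T : ℕ → ℕ → ℕ) : Prop :=
  ∀ i j k, 1 ≤ i → i < j → j < k → k ≤ n → LBal T i j k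

/-- Inversions tableau for `w`: balanced column-injective tableau whose entries in
row `i` are at most `i`. -/
def InvTab {n : ℕ} (w : Equiv.Perm (Fin n)) (T : ℕ → ℕ → ℕ) : Prop :=
  ColInj w T ∧ BalancedTab n T ∧ ∀ i j, T i j ≤ i

/-- The multiset of entries of `T` on `hook(i,k)`. -/
def hookEntries (T : ℕ → ℕ → ℕ) (i k : ℕ) : Multiset ℕ :=
  (T i k ::ₘ (Finset.Ioo i k).val.map fun r => T r k) +
    (Finset.Ioo i k).val.map fun c => T i c

/-- The median ((k-i)-th smallest of the `2(k-i)-1` entries) of the hook of `(i,k)`. -/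
def hookMedian (T : ℕ → ℕ → ℕ) (i k : ℕ) : ℕ :=
  ((hookEntries T i k).sort (· ≤ ·)).getD (k - i - 1) 0

/-! ## Pipe dreams

A pipe dream in the staircase `Δ_n` is encoded by `P : ℕ → ℕ → Bool`, where
`P i j = true` means box `(i,j)` (row `i` from the top, column `j` from the left,
with `1 ≤ i, j` and `i + j ≤ n`) is a cross tile, and `false` means a bump tile;
boxes on the southeast boundary (`i + j = n + 1`) are elbow tiles. -/

/-- `labels n P i j` is the pair (label of the north edge, label of the east edge) of
the pipes passing through box `(i,j)`:  pipes enter at row `k` on the west side with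
label `k` and propagate through cross, bump and elbow tiles. -/
def labels (n : ℕ) (P : ℕ → ℕ → Bool) (i j : ℕ) : ℕ × ℕ :=
  let west := if _h1 : j ≤ 1 then i else (labels n P i (j - 1)).2
  if _h : i + j ≤ n then
    if P i j then ((labels n P (i + 1) j).1, west)
    else (west, (labels n P (i + 1) j).1)
  else (west, west)
termination_by (n + 1 - i) + j
decreasing_by all_goals omega

def northLabel (n : ℕ) (P : ℕ → ℕ → Bool) (i j : ℕ) : ℕ := (labels n P i j).1

def westLabel (n : ℕ) (P : ℕ → ℕ → Bool) (i j : ℕ) : ℕ :=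
  if j ≤ 1 then i else (labels n P i (j - 1)).2

def southLabel (n : ℕ) (P : ℕ → ℕ → Bool) (i j : ℕ) : ℕ := (labels n P (i + 1) j).1

/-- Pipes `p` and `q` cross at box `(i,j)` of `P`. -/
def CrossAt (n : ℕ) (P : ℕ → ℕ → Bool) (i j p q : ℕ) : Prop :=
  1 ≤ i ∧ 1 ≤ j ∧ i + j ≤ n ∧ P i j = true ∧
    ((westLabel n P i j = p ∧ southLabel n P i j = q) ∨
      (westLabel n P i j = q ∧ southLabel n P i j = p))

/-- `P` is a pipe dream for `w`: crosses lie in the staircase, and reading the pipe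
labels along the north side gives the one-line notation of `w`. -/
def IsPD {n : ℕ} (w : Equiv.Perm (Fin n)) (P : ℕ → ℕ → Bool) : Prop :=
  (∀ i j, P i j = true → 1 ≤ i ∧ 1 ≤ j ∧ i + j ≤ n) ∧
    ∀ j, 1 ≤ j → j ≤ n → northLabel n P 1 j = permVal w j

/-- `P` is reduced: no two pipes cross more than once. -/
def Reduced (n : ℕ) (P : ℕ → ℕ → Bool) : Prop :=
  ∀ p q i j i' j', CrossAt n P i j p q → CrossAt n P i' j' p q → i = i' ∧ j = j'

/-- The set of reduced pipe dreams for `w`. -/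
def RPD {n : ℕ} (w : Equiv.Perm (Fin n)) :=
  { P : ℕ → ℕ → Bool // IsPD w P ∧ Reduced n P }

/-- `R` is a rectangle (rows `a < b`, columns `c < d`) in which a chute move of `P`
can take place: `NW(R)=(a,c)` and `SW(R)=(b,c)` are bumps, `SE(R)=(b,d)` is a bump or
elbow, and all other boxes of `R` are crosses. -/
def IsChuteRect (n : ℕ) (P : ℕ → ℕ → Bool) (a b c d : ℕ) : Prop :=
  1 ≤ a ∧ a < b ∧ 1 ≤ c ∧ c < d ∧ b + d ≤ n + 1 ∧
    P a c = false ∧ P b c = false ∧ P b d = false ∧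
    ∀ i j, a ≤ i → i ≤ b → c ≤ j → j ≤ d →
      ¬(i = a ∧ j = c) → ¬(i = b ∧ j = c) → ¬(i = b ∧ j = d) → P i j = true

/-- The result of the chute move in the rectangle with corners `(a,c)`, `(b,d)`:
the bump at `SW=(b,c)` becomes a cross and the cross at `NE=(a,d)` becomes a bump. -/
def chuteResult (P : ℕ → ℕ → Bool) (a b c d : ℕ) : ℕ → ℕ → Bool :=
  fun i j => if i = b ∧ j = c then true else if i = a ∧ j = d then false else P i j

/-- `P'` is obtained from `P` by a single chute move. -/
def ChuteStep (n : ℕ) (P P' : ℕ → ℕ → Bool) : Prop :=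
  ∃ a b c d, IsChuteRect n P a b c d ∧ P' = chuteResult P a b c d

/-- The chute move order on `RPD w`: `P ≤ Q` iff `Q` is obtained from `P`
by a sequence of chute moves. -/
def chuteLE {n : ℕ} (w : Equiv.Perm (Fin n)) (P Q : RPD w) : Prop :=
  Relation.ReflTransGen (fun X Y : RPD w => ChuteStep n X.1 Y.1) P Q

/-- `theta n P p q` is the index of the row in which pipes `p` and `q` cross in `P`
(`0` if they do not cross).  For `P ∈ PD(w)` reduced, `theta n P` is the inversions
tableau `Θ(P)`. -/
def theta (n : ℕ) (P : ℕ → ℕ → Bool) (p q : ℕ) : ℕ :=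
  if h : ∃ rc : ℕ × ℕ, CrossAt n P rc.1 rc.2 p q then (Classical.choose h).1 else 0

/-- The Lehmer tableau `Φ(P) = Λ(Θ(P))` of a pipe dream. -/
def phi (n : ℕ) (P : ℕ → ℕ → Bool) (i j : ℕ) : ℕ := lehmer (theta n P) i j

/-- Cover relation of the chute move order. -/
def chuteCovBy {n : ℕ} (w : Equiv.Perm (Fin n)) (P Q : RPD w) : Prop :=
  chuteLE w P Q ∧ P ≠ Q ∧ ∀ R, chuteLE w P R → chuteLE w R Q → R = P ∨ R = Q

/-- The interval `[P, Q]` in the chute move order. -/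
def chuteIcc {n : ℕ} (w : Equiv.Perm (Fin n)) (P Q : RPD w) : Set (RPD w) :=
  { R | chuteLE w P R ∧ chuteLE w R Q }

/-- A chain in the chute move order. -/
def chuteChain {n : ℕ} (w : Equiv.Perm (Fin n)) (C : Set (RPD w)) : Prop :=
  ∀ x ∈ C, ∀ y ∈ C, chuteLE w x y ∨ chuteLE w y x

/-- `[P,Q]` is a polygon: an interval of cardinality at least 4 that is the union of
two chains whose intersection is `{P, Q}`. -/
def IsPolygon {n : ℕ} (w : Equiv.Perm (Fin n)) (P Q : RPD w) : Prop :=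
  chuteLE w P Q ∧ 4 ≤ (chuteIcc w P Q).ncard ∧
    ∃ C₁ C₂ : Set (RPD w), chuteChain w C₁ ∧ chuteChain w C₂ ∧
      C₁ ∪ C₂ = chuteIcc w P Q ∧ C₁ ∩ C₂ = {P, Q}

/-- `m` is the meet (greatest lower bound) of `P` and `Q` in the chute move order. -/
def IsMeetOf {n : ℕ} (w : Equiv.Perm (Fin n)) (m P Q : RPD w) : Prop :=
  chuteLE w m P ∧ chuteLE w m Q ∧ ∀ r, chuteLE w r P → chuteLE w r Q → chuteLE w r m

/-- `s` is the join (least upper bound) of `P` and `Q` in the chute move order. -/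
def IsJoinOf {n : ℕ} (w : Equiv.Perm (Fin n)) (s P Q : RPD w) : Prop :=
  chuteLE w P s ∧ chuteLE w Q s ∧ ∀ r, chuteLE w P r → chuteLE w Q r → chuteLE w s r

namespace PipeDream

open Equiv

/-! ### Pipe dreams as words in adjacent transpositions -/

/-- The permutation of labels reached after reading the first `t` boxes of the `n × n` grid, rows
from bottom to top and each row from left to right. -/
def state (n : ℕ) (P : ℕ → ℕ → Bool) : ℕ → Perm ℕ
  | 0 => 1
  | t + 1 => state n P t *
      if P (n - t / n) (t % n + 1) then swap (n - t / n + t % n) (n - t / n + t % n + 1) else 1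

/-- The box read at time `t` is a cross of the pipes `x` and `y`. -/
def CrossTime (n : ℕ) (P : ℕ → ℕ → Bool) (t x y : ℕ) : Prop :=
  P (n - t / n) (t % n + 1) = true ∧
    ((state n P t (n - t / n + t % n) = x ∧ state n P t (n - t / n + t % n + 1) = y) ∨
      (state n P t (n - t / n + t % n) = y ∧ state n P t (n - t / n + t % n + 1) = x))

/-- The time at which box `(r, c)` is read. -/
def boxTime (n r c : ℕ) : ℕ := (n - r) * n + (c - 1)

/-- No pair of pipes crosses at two different times. -/
def TimeReduced (n : ℕ) (P : ℕ → ℕ → Bool) : Prop :=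
  ∀ x y t t', CrossTime n P t x y → CrossTime n P t' x y → t = t'

/-- All crosses lie in the staircase. -/
def Supported (n : ℕ) (P : ℕ → ℕ → Bool) : Prop :=
  ∀ i j, P i j = true → 1 ≤ i ∧ 1 ≤ j ∧ i + j ≤ n

variable {n : ℕ} {P : ℕ → ℕ → Bool}

theorem CrossTime.symm {t x y : ℕ} (h : CrossTime n P t x y) : CrossTime n P t y x :=
  ⟨h.1, h.2.symm⟩

theorem CrossTime.ne {t x y : ℕ} (h : CrossTime n P t x y) : x ≠ y := by
  rintro rfl
  have : state n P t (n - t / n + t % n) = state n P t (n - t / n + t % n + 1) := by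
    rcases h.2 with h | h <;> rw [h.1, h.2]
  have := (state n P t).injective this
  omega

theorem state_succ_symm (t x : ℕ) : (state n P (t + 1)).symm x =
    (if P (n - t / n) (t % n + 1) then swap (n - t / n + t % n) (n - t / n + t % n + 1) else 1)
      ((state n P t).symm x) := by
  rw [Equiv.symm_apply_eq]
  simp only [state]
  split_ifs <;> simp [Perm.mul_apply]

theorem state_symm_lt_of_not_crossTime {t x y : ℕ} (hxy : x ≠ y) (h : ¬ CrossTime n P t x y) :
    (state n P (t + 1)).symm x < (state n P (t + 1)).symm y ↔
      (state n P t).symm x < (state n P t).symm y := by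
  rw [state_succ_symm, state_succ_symm]
  split_ifs with hP
  · have hne : (state n P t).symm x ≠ (state n P t).symm y :=
      fun e => hxy ((state n P t).symm.injective e)
    have h1 : ¬ ((state n P t).symm x = n - t / n + t % n ∧
        (state n P t).symm y = n - t / n + t % n + 1) := by
      rintro ⟨e1, e2⟩
      rw [Equiv.symm_apply_eq] at e1 e2
      exact h ⟨hP, Or.inl ⟨e1.symm, e2.symm⟩⟩
    have h2 : ¬ ((state n P t).symm y = n - t / n + t % n ∧
        (state n P t).symm x = n - t / n + t % n + 1) := by
      rintro ⟨e1, e2⟩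
      rw [Equiv.symm_apply_eq] at e1 e2
      exact h ⟨hP, Or.inr ⟨e1.symm, e2.symm⟩⟩
    generalize (state n P t).symm x = p at *
    generalize (state n P t).symm y = q at *
    generalize n - t / n + t % n = k at *
    simp only [swap_apply_def]
    split_ifs <;> omega
  · simp

theorem state_symm_lt_of_crossTime {t x y : ℕ} (h : CrossTime n P t x y) :
    (state n P (t + 1)).symm x < (state n P (t + 1)).symm y ↔
      (state n P t).symm y < (state n P t).symm x := by
  rw [state_succ_symm, state_succ_symm, if_pos h.1]
  rcases h.2 with ⟨rfl, rfl⟩ | ⟨rfl, rfl⟩ <;> simp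

theorem state_symm_ne {x y : ℕ} (hxy : x ≠ y) (t : ℕ) :
    (state n P t).symm x ≠ (state n P t).symm y :=
  fun e => hxy ((state n P t).symm.injective e)

/-- In a reduced word, two pipes `x < y` appear in reverse order exactly after they crossed. -/
theorem state_symm_lt_iff (hr : TimeReduced n P) {x y : ℕ} (hxy : x < y) (t : ℕ) :
    (state n P t).symm y < (state n P t).symm x ↔ ∃ s < t, CrossTime n P s x y := by
  induction t with
  | zero =>
    have h : ∀ z, (state n P 0).symm z = z := fun _ => rfl
    simp [h, hxy.le]
  | succ t ih =>
    by_cases h : CrossTime n P t x y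
    · rw [state_symm_lt_of_crossTime h.symm]
      refine ⟨fun _ => ⟨t, by omega, h⟩, fun _ => ?_⟩
      have : ¬ (state n P t).symm y < (state n P t).symm x := by
        rw [ih]
        rintro ⟨s, hs, hc⟩
        exact absurd (hr x y s t hc h) (by omega)
      have := state_symm_ne (n := n) (P := P) hxy.ne t
      omega
    · rw [state_symm_lt_of_not_crossTime hxy.ne' (fun h' => h h'.symm), ih]
      constructor
      · rintro ⟨s, hs, hc⟩
        exact ⟨s, by omega, hc⟩
      · rintro ⟨s, hs, hc⟩
        refine ⟨s, ?_, hc⟩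
        rcases Nat.lt_succ_iff_lt_or_eq.mp hs with h1 | rfl
        · exact h1
        · exact absurd hc h

theorem CrossTime.state_eq (hr : TimeReduced n P) {t x y : ℕ} (hxy : x < y)
    (h : CrossTime n P t x y) :
    state n P t (n - t / n + t % n) = x ∧ state n P t (n - t / n + t % n + 1) = y := by
  rcases h.2 with h' | ⟨h1, h2⟩
  · exact h'
  · have : (state n P t).symm y < (state n P t).symm x := by
      rw [← h1, ← h2]; simp
    rw [state_symm_lt_iff hr hxy] at this
    obtain ⟨s, hs, hc⟩ := this
    exact absurd (hr x y s t hc h) (by omega)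

theorem state_fix (hs : Supported n P) {k : ℕ} (hk : k = 0 ∨ n < k) (t : ℕ) :
    state n P t k = k := by
  induction t with
  | zero => simp [state]
  | succ t ih =>
    simp only [state]
    split_ifs with h
    · have := hs _ _ h
      rw [Perm.mul_apply, swap_apply_of_ne_of_ne (by omega) (by omega), ih]
    · simpa using ih

theorem state_mem (hs : Supported n P) {k : ℕ} (h1 : 1 ≤ k) (h2 : k ≤ n) (t : ℕ) :
    1 ≤ state n P t k ∧ state n P t k ≤ n := by
  by_contra hc
  have h0 : state n P t k = 0 ∨ n < state n P t k := by omega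
  have := state_fix hs h0 t
  have := (state n P t).injective this
  omega

/-! ### Edge labels -/

theorem westLabel_one (r : ℕ) : westLabel n P r 1 = r := by simp [westLabel]

theorem labels_eq (i j : ℕ) : labels n P i j =
    if i + j ≤ n then
      if P i j then (northLabel n P (i + 1) j, westLabel n P i j)
      else (westLabel n P i j, northLabel n P (i + 1) j)
    else (westLabel n P i j, westLabel n P i j) := by
  rw [labels]
  simp only [northLabel, westLabel]
  split_ifs <;> rfl

theorem north_of_cross {r c : ℕ} (h : r + c ≤ n) (hP : P r c = true) :
    northLabel n P r c = northLabel n P (r + 1) c := by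
  rw [northLabel, labels_eq, if_pos h, if_pos hP]

theorem north_of_bump {r c : ℕ} (hP : P r c = false) :
    northLabel n P r c = westLabel n P r c := by
  rw [northLabel, labels_eq]
  split_ifs <;> simp_all

theorem west_succ_of_cross {r c : ℕ} (hc : 1 ≤ c) (h : r + c ≤ n) (hP : P r c = true) :
    westLabel n P r (c + 1) = westLabel n P r c := by
  rw [westLabel, if_neg (by omega), Nat.add_sub_cancel, labels_eq, if_pos h, if_pos hP]

theorem west_succ_of_bump {r c : ℕ} (hc : 1 ≤ c) (h : r + c ≤ n) (hP : P r c = false) :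
    westLabel n P r (c + 1) = northLabel n P (r + 1) c := by
  rw [westLabel, if_neg (by omega), Nat.add_sub_cancel, labels_eq, if_pos h, hP]
  simp

/-- The label at position `k` just before box `(r, c)` is read. -/
def stateLabel (n : ℕ) (P : ℕ → ℕ → Bool) (r c k : ℕ) : ℕ :=
  if k < r ∨ n < k then k else
    if k + 1 < r + c then northLabel n P r (k + 1 - r)
    else if k + 1 = r + c then westLabel n P r c
    else northLabel n P (r + 1) (k - r)

theorem boxTime_div {r c : ℕ} (hc : 1 ≤ c) (hcn : c ≤ n) :
    boxTime n r c / n = n - r := by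
  rw [boxTime, mul_comm, Nat.mul_add_div (by omega), Nat.div_eq_of_lt (by omega), add_zero]

theorem boxTime_mod {r c : ℕ} (hc : 1 ≤ c) (hcn : c ≤ n) :
    boxTime n r c % n = c - 1 := by
  rw [boxTime, mul_comm, Nat.mul_add_mod, Nat.mod_eq_of_lt (by omega)]

theorem boxTime_succ {r c : ℕ} (hc : 1 ≤ c) : boxTime n r (c + 1) = boxTime n r c + 1 := by
  simp only [boxTime]; omega

theorem boxTime_row {r : ℕ} (hr : 1 ≤ r) (hrn : r ≤ n) :
    boxTime n (r - 1) 1 = boxTime n r n + 1 := by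
  have h : n - (r - 1) = (n - r) + 1 := by omega
  simp only [boxTime, h, add_mul]; omega

theorem boxTime_lt_iff {r c r' c' : ℕ} (hc : 1 ≤ c) (hcn : c ≤ n) (hc' : 1 ≤ c') (hcn' : c' ≤ n)
    (hr : r ≤ n) (hr' : r' ≤ n) :
    boxTime n r c < boxTime n r' c' ↔ r' < r ∨ (r = r' ∧ c < c') := by
  simp only [boxTime]
  rcases lt_trichotomy r r' with h | rfl | h
  · have : n - r' + 1 ≤ n - r := by omega
    have := Nat.mul_le_mul_right n this
    rw [add_mul] at this
    constructor <;> intro <;> omega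
  · constructor <;> intro <;> omega
  · have : n - r + 1 ≤ n - r' := by omega
    have := Nat.mul_le_mul_right n this
    rw [add_mul] at this
    constructor <;> intro <;> omega

theorem state_succ_boxTime {r c : ℕ} (hr : r ≤ n) (hc : 1 ≤ c) (hcn : c ≤ n) :
    state n P (boxTime n r c + 1) = state n P (boxTime n r c) *
      if P r c then swap (r + c - 1) (r + c) else 1 := by
  simp only [state, boxTime_div hc hcn, boxTime_mod hc hcn]
  rw [show n - (n - r) = r by omega, show c - 1 + 1 = c by omega,
    show r + (c - 1) = r + c - 1 by omega, show r + c - 1 + 1 = r + c by omega]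

theorem state_succ_box (hs : Supported n P) {r c : ℕ} (hr : 1 ≤ r) (hrn : r ≤ n) (hc : 1 ≤ c)
    (hcn : c ≤ n) (h : ∀ k, state n P (boxTime n r c) k = stateLabel n P r c k) (k : ℕ) :
    state n P (boxTime n r c + 1) k = stateLabel n P r (c + 1) k := by
  rw [state_succ_boxTime hrn hc hcn]
  split_ifs with hP
  · have hb := hs _ _ hP
    rw [Perm.mul_apply, h, swap_apply_def]
    by_cases h1 : k = r + c - 1
    · rw [if_pos h1, stateLabel, stateLabel, if_neg (by omega), if_neg (by omega),
        if_neg (by omega), if_neg (by omega), if_pos (by omega),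
        show r + c - r = c by omega, show k + 1 - r = c by omega, north_of_cross hb.2.2 hP]
    · by_cases h2 : k = r + c
      · rw [if_neg h1, if_pos h2, stateLabel, stateLabel, if_neg (by omega), if_neg (by omega),
        if_pos (by omega), if_neg (by omega), if_neg (by omega), if_pos (by omega),
        west_succ_of_cross hc hb.2.2 hP]
      · rw [if_neg h1, if_neg h2, stateLabel, stateLabel]
        split_ifs <;> first | rfl | omega
  · have hP' : P r c = false := by simpa using hP
    rw [mul_one, h, stateLabel, stateLabel]
    by_cases h0 : k < r ∨ n < k
    · rw [if_pos h0, if_pos h0]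
    · rw [if_neg h0, if_neg h0]
      by_cases h1 : k = r + c - 1
      · rw [if_neg (by omega), if_pos (by omega), if_pos (by omega),
          show k + 1 - r = c by omega, north_of_bump hP']
      · by_cases h2 : k = r + c
        · rw [if_neg (by omega), if_neg (by omega), if_neg (by omega), if_pos (by omega),
            west_succ_of_bump hc (by omega) hP', show k - r = c by omega]
        · split_ifs <;> first | rfl | omega

theorem state_eq_stateLabel_row (hs : Supported n P) {r : ℕ} (hr : 1 ≤ r) (hrn : r ≤ n)
    (h : ∀ k, state n P (boxTime n r 1) k = stateLabel n P r 1 k) {c : ℕ} (hc : 1 ≤ c)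
    (hcn : c ≤ n) (k : ℕ) : state n P (boxTime n r c) k = stateLabel n P r c k := by
  induction c, hc using Nat.le_induction generalizing k with
  | base => exact h k
  | succ c hc ih =>
    rw [boxTime_succ hc]
    exact state_succ_box hs hr hrn hc (by omega) (ih (by omega)) k

theorem state_eq_stateLabel_first (hs : Supported n P) {s : ℕ} (hsn : s < n) (k : ℕ) :
    state n P (boxTime n (n - s) 1) k = stateLabel n P (n - s) 1 k := by
  induction s generalizing k with
  | zero =>
    have : boxTime n (n - 0) 1 = 0 := by simp [boxTime]
    rw [this, stateLabel]
    simp only [state, Perm.one_apply]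
    split_ifs
    · rfl
    · omega
    · rw [westLabel_one]; omega
    · omega
  | succ s ih =>
    have e : n - (s + 1) = n - s - 1 := by omega
    rw [e, boxTime_row (by omega) (by omega),
      state_succ_box hs (by omega) (by omega) (by omega) le_rfl
        (state_eq_stateLabel_row hs (by omega) (by omega) (ih (by omega)) (by omega) le_rfl)]
    simp only [stateLabel]
    rcases lt_trichotomy k (n - s - 1) with h | h | h
    · rw [if_pos (by omega), if_pos (by omega)]
    · rw [if_pos (by omega), if_neg (by omega), if_neg (by omega), if_pos (by omega),
        westLabel_one, h]
    · by_cases h' : n < k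
      · rw [if_pos (by omega), if_pos (by omega)]
      · rw [if_neg (by omega), if_pos (by omega), if_neg (by omega), if_neg (by omega),
          if_neg (by omega), show n - s - 1 + 1 = n - s by omega,
          show k + 1 - (n - s) = k - (n - s - 1) by omega]

theorem state_boxTime (hs : Supported n P) {r c : ℕ} (hr : 1 ≤ r) (hrn : r ≤ n) (hc : 1 ≤ c)
    (hcn : c ≤ n) (k : ℕ) : state n P (boxTime n r c) k = stateLabel n P r c k := by
  refine state_eq_stateLabel_row hs hr hrn (fun k => ?_) hc hcn k
  have := state_eq_stateLabel_first hs (s := n - r) (by omega) k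
  rwa [show n - (n - r) = r by omega] at this

theorem state_west (hs : Supported n P) {r c : ℕ} (hr : 1 ≤ r) (hc : 1 ≤ c)
    (h : r + c ≤ n + 1) : state n P (boxTime n r c) (r + c - 1) = westLabel n P r c := by
  rw [state_boxTime hs hr (by omega) hc (by omega), stateLabel, if_neg (by omega),
    if_neg (by omega), if_pos (by omega)]

theorem state_south (hs : Supported n P) {r c c' : ℕ} (hr : 1 ≤ r) (hc : 1 ≤ c)
    (hcc : c ≤ c') (h : r + c' ≤ n) :
    state n P (boxTime n r c) (r + c') = northLabel n P (r + 1) c' := by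
  rw [state_boxTime hs hr (by omega) hc (by omega), stateLabel, if_neg (by omega),
    if_neg (by omega), if_neg (by omega), Nat.add_sub_cancel_left]

theorem state_north (hs : Supported n P) {r c c' : ℕ} (hr : 1 ≤ r) (hc' : 1 ≤ c')
    (hcc : c' < c) (hcn : c ≤ n) (h : r + c' ≤ n + 1) :
    state n P (boxTime n r c) (r + c' - 1) = northLabel n P r c' := by
  rw [state_boxTime hs hr (by omega) (by omega) (by omega), stateLabel, if_neg (by omega),
    if_pos (by omega), show r + c' - 1 + 1 - r = c' by omega]

/-- Reading off the north labels of row `r` after that row is completed. -/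
theorem state_row_end (hs : Supported n P) {r c : ℕ} (hr : 1 ≤ r) (hc : 1 ≤ c)
    (h : r + c ≤ n + 1) :
    state n P (boxTime n r n + 1) (r + c - 1) = northLabel n P r c := by
  rw [state_succ_box hs hr (by omega) (by omega) le_rfl
    (state_boxTime hs hr (by omega) (by omega) le_rfl), stateLabel, if_neg (by omega),
    if_pos (by omega), show r + c - 1 + 1 - r = c by omega]

theorem north_injective (hs : Supported n P) {r c c' : ℕ} (hr : 1 ≤ r) (hc : 1 ≤ c)
    (hc' : 1 ≤ c') (h : r + c ≤ n + 1) (h' : r + c' ≤ n + 1)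
    (e : northLabel n P r c = northLabel n P r c') : c = c' := by
  rw [← state_row_end hs hr hc h, ← state_row_end hs hr hc' h'] at e
  have := (state n P _).injective e
  omega

theorem west_ne_south (hs : Supported n P) {r c c' : ℕ} (hr : 1 ≤ r) (hc : 1 ≤ c)
    (hcc : c ≤ c') (h : r + c' ≤ n) : westLabel n P r c ≠ northLabel n P (r + 1) c' := by
  rw [← state_west hs hr hc (by omega), ← state_south hs hr hc hcc h]
  intro e
  have := (state n P _).injective e
  omega

theorem west_ne_north (hs : Supported n P) {r c c' : ℕ} (hr : 1 ≤ r) (hc' : 1 ≤ c')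
    (hcc : c' < c) (h : r + c ≤ n + 1) : westLabel n P r c ≠ northLabel n P r c' := by
  rw [← state_west hs hr (by omega) h, ← state_north hs hr hc' hcc (by omega) (by omega)]
  intro e
  have := (state n P _).injective e
  omega

/-! ### Crossings of pipes in boxes and in time -/

theorem crossTime_boxTime (hs : Supported n P) {r c x y : ℕ} (hr : 1 ≤ r) (hc : 1 ≤ c)
    (h : r + c ≤ n) : CrossTime n P (boxTime n r c) x y ↔ CrossAt n P r c x y := by
  simp only [CrossTime, CrossAt, boxTime_div hc (show c ≤ n by omega),
    boxTime_mod hc (show c ≤ n by omega)]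
  rw [show n - (n - r) = r by omega, show c - 1 + 1 = c by omega,
    show r + (c - 1) = r + c - 1 by omega, show r + c - 1 + 1 = r + c by omega,
    state_west hs hr hc (by omega), state_south hs hr hc le_rfl h]
  simp [hr, hc, h, southLabel, northLabel]

theorem CrossTime.exists_box (hs : Supported n P) {t x y : ℕ} (h : CrossTime n P t x y) :
    t = boxTime n (n - t / n) (t % n + 1) ∧ CrossAt n P (n - t / n) (t % n + 1) x y := by
  have hb := hs _ _ h.1
  have ht : t = boxTime n (n - t / n) (t % n + 1) := by
    rw [boxTime, show n - (n - t / n) = t / n by omega, Nat.add_sub_cancel, mul_comm,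
      Nat.div_add_mod]
  refine ⟨ht, ?_⟩
  rw [← crossTime_boxTime hs hb.1 hb.2.1 hb.2.2, ← ht]
  exact h

theorem _root_.CrossAt.symm {r c x y : ℕ} (h : CrossAt n P r c x y) : CrossAt n P r c y x :=
  ⟨h.1, h.2.1, h.2.2.1, h.2.2.2.1, h.2.2.2.2.symm⟩

theorem _root_.CrossAt.crossTime (hs : Supported n P) {r c x y : ℕ} (h : CrossAt n P r c x y) :
    CrossTime n P (boxTime n r c) x y :=
  (crossTime_boxTime hs h.1 h.2.1 h.2.2.1).2 h

theorem reduced_iff_timeReduced (hs : Supported n P) : Reduced n P ↔ TimeReduced n P := by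
  constructor
  · intro h x y t t' ht ht'
    obtain ⟨e, hc⟩ := ht.exists_box hs
    obtain ⟨e', hc'⟩ := ht'.exists_box hs
    obtain ⟨h1, h2⟩ := h _ _ _ _ _ _ hc hc'
    rw [e, e', h1, h2]
  · intro h x y r c r' c' hc hc'
    have e := h _ _ _ _ (hc.crossTime hs) (hc'.crossTime hs)
    have e1 := congrArg (· / n) e
    have e2 := congrArg (· % n) e
    have b := hc.2.2
    have b' := hc'.2.2
    simp only [boxTime_div hc.2.1 (show c ≤ n by omega),
      boxTime_div hc'.2.1 (show c' ≤ n by omega), boxTime_mod hc.2.1 (show c ≤ n by omega),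
      boxTime_mod hc'.2.1 (show c' ≤ n by omega)] at e1 e2
    have := hc.1
    have := hc.2.1
    have := hc'.2.1
    omega

theorem _root_.CrossAt.labels_eq (hs : Supported n P) (hr : Reduced n P) {r c x y : ℕ} (hxy : x < y)
    (h : CrossAt n P r c x y) : westLabel n P r c = x ∧ northLabel n P (r + 1) c = y := by
  rcases h.2.2.2.2 with h' | h'
  · exact h'
  · have := (h.crossTime hs).state_eq ((reduced_iff_timeReduced hs).1 hr) hxy
    have hc := h.2.1
    have hb := h.2.2.1
    rw [boxTime_div hc (show c ≤ n by omega), boxTime_mod hc (show c ≤ n by omega),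
      show n - (n - r) = r by omega, show r + (c - 1) = r + c - 1 by omega,
      show r + c - 1 + 1 = r + c by omega, state_west hs h.1 hc (by omega),
      state_south hs h.1 hc le_rfl hb] at this
    exact this

theorem _root_.CrossAt.ne (hs : Supported n P) {r c x y : ℕ} (h : CrossAt n P r c x y) : x ≠ y :=
  (h.crossTime hs).ne

theorem _root_.CrossAt.mem (hs : Supported n P) {r c x y : ℕ} (h : CrossAt n P r c x y) :
    1 ≤ x ∧ x ≤ n := by
  have hc := h.2.1
  have hb := h.2.2.1
  have hr := h.1
  have h1 := state_mem hs (k := r + c - 1) (by omega) (by omega) (boxTime n r c)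
  have h2 := state_mem hs (k := r + c) (by omega) (by omega) (boxTime n r c)
  rw [state_west hs hr hc (by omega)] at h1
  rw [state_south hs hr hc le_rfl hb] at h2
  rcases h.2.2.2.2 with h' | h'
  · rw [← h'.1]; exact h1
  · rw [← h'.2]; exact h2

end PipeDream

namespace PipeDream

open Equiv

variable {n : ℕ} {P Q : ℕ → ℕ → Bool}

/-! ### The inversions tableau -/

theorem theta_eq_of_crossAt (hr : Reduced n P) {r c x y : ℕ} (h : CrossAt n P r c x y) :
    theta n P x y = r := by
  have hex : ∃ rc : ℕ × ℕ, CrossAt n P rc.1 rc.2 x y := ⟨(r, c), h⟩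
  rw [theta, dif_pos hex]
  exact (hr _ _ _ _ _ _ (Classical.choose_spec hex) h).1

theorem exists_crossAt_of_theta_ne_zero {x y : ℕ} (h : theta n P x y ≠ 0) :
    ∃ c, CrossAt n P (theta n P x y) c x y := by
  by_cases hex : ∃ rc : ℕ × ℕ, CrossAt n P rc.1 rc.2 x y
  · rw [theta, dif_pos hex]
    exact ⟨_, Classical.choose_spec hex⟩
  · rw [theta, dif_neg hex] at h
    exact absurd rfl h

theorem theta_ne_zero_iff (hr : Reduced n P) {x y : ℕ} :
    theta n P x y ≠ 0 ↔ ∃ r c, CrossAt n P r c x y := by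
  constructor
  · intro h
    obtain ⟨c, hc⟩ := exists_crossAt_of_theta_ne_zero h
    exact ⟨_, c, hc⟩
  · rintro ⟨r, c, h⟩
    rw [theta_eq_of_crossAt hr h]
    have := h.1
    omega

theorem theta_eq_of_crossTime (hs : Supported n P) (hr : Reduced n P) {t x y : ℕ}
    (h : CrossTime n P t x y) : theta n P x y = n - t / n :=
  theta_eq_of_crossAt hr (h.exists_box hs).2

theorem exists_crossTime_of_theta_ne_zero (hs : Supported n P) {x y : ℕ}
    (h : theta n P x y ≠ 0) : ∃ t, CrossTime n P t x y := by
  obtain ⟨c, hc⟩ := exists_crossAt_of_theta_ne_zero h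
  exact ⟨_, hc.crossTime hs⟩

theorem theta_eq_zero_of_forall (hs : Supported n P) {x y : ℕ}
    (h : ∀ t, ¬ CrossTime n P t x y) : theta n P x y = 0 := by
  by_contra hne
  obtain ⟨t, ht⟩ := exists_crossTime_of_theta_ne_zero hs hne
  exact h t ht

theorem CrossTime.lt (hs : Supported n P) {t x y : ℕ} (h : CrossTime n P t x y) : t < n * n := by
  have := (hs _ _ h.1).1
  by_contra hc
  rcases Nat.eq_zero_or_pos n with rfl | hn
  · simp at this
  · have := Nat.div_le_div_right (c := n) (not_lt.1 hc)
    rw [Nat.mul_div_cancel _ hn] at this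
    omega

/-- Properties of the inversions tableau of a reduced pipe dream. -/
structure IsBalancedColInj (T : ℕ → ℕ → ℕ) : Prop where
  balanced : ∀ x y z, x < y → y < z → LBal T x y z
  inj : ∀ x x' y, x < y → x' < y → x ≠ x' → T x y ≠ 0 → T x y ≠ T x' y

theorem theta_row_le (hs : Supported n P) (hr : Reduced n P) {x y s t : ℕ} (hst : s ≤ t)
    (hc : CrossTime n P s x y) : n - t / n ≤ theta n P x y := by
  rw [theta_eq_of_crossTime hs hr hc]
  have := Nat.div_le_div_right (c := n) hst
  omega

theorem theta_le_row (hs : Supported n P) (hr : Reduced n P) {x y t : ℕ}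
    (h : ¬ ∃ s < t, CrossTime n P s x y) : theta n P x y ≤ n - t / n := by
  by_contra hc
  obtain ⟨s, hs'⟩ := exists_crossTime_of_theta_ne_zero hs (show theta n P x y ≠ 0 by omega)
  rw [theta_eq_of_crossTime hs hr hs'] at hc
  apply h
  refine ⟨s, ?_, hs'⟩
  by_contra hst
  have := Nat.div_le_div_right (c := n) (not_lt.1 hst)
  omega

theorem isBalancedColInj_theta (hs : Supported n P) (hr : Reduced n P) :
    IsBalancedColInj (theta n P) where
  balanced x y z hxy hyz := by
    have ht := (reduced_iff_timeReduced hs).1 hr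
    have hxz := hxy.trans hyz
    by_cases h : theta n P x z = 0
    · have hN : ¬ ∃ s < n * n, CrossTime n P s x z := by
        rintro ⟨s, -, hc⟩
        exact (theta_ne_zero_iff hr).2 ⟨_, _, (hc.exists_box hs).2⟩ h
      rw [← state_symm_lt_iff ht hxz] at hN
      have key : theta n P x y = 0 ∨ theta n P y z = 0 := by
        by_contra! hne
        obtain ⟨t1, h1⟩ := exists_crossTime_of_theta_ne_zero hs hne.1
        obtain ⟨t2, h2⟩ := exists_crossTime_of_theta_ne_zero hs hne.2
        have h1' := (state_symm_lt_iff ht hxy _).2 ⟨t1, h1.lt hs, h1⟩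
        have h2' := (state_symm_lt_iff ht hyz _).2 ⟨t2, h2.lt hs, h2⟩
        omega
      rw [LBal, h]
      rcases key with h | h <;> simp [h]
    · obtain ⟨t, hc⟩ := exists_crossTime_of_theta_ne_zero hs h
      have e := theta_eq_of_crossTime hs hr hc
      have hst := hc.state_eq ht hxz
      have px : (state n P t).symm x = n - t / n + t % n := by
        rw [Equiv.symm_apply_eq]; exact hst.1.symm
      have pz : (state n P t).symm z = n - t / n + t % n + 1 := by
        rw [Equiv.symm_apply_eq]; exact hst.2.symm
      have nx := state_symm_ne (n := n) (P := P) hxy.ne t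
      have nz := state_symm_ne (n := n) (P := P) hyz.ne t
      have kxy := state_symm_lt_iff ht hxy t
      have kyz := state_symm_lt_iff ht hyz t
      rcases lt_or_gt_of_ne nx with h1 | h1
      · have hy : (state n P t).symm z < (state n P t).symm y := by omega
        obtain ⟨s, hs1, hs2⟩ := kyz.1 hy
        have g1 := theta_row_le hs hr hs1.le hs2
        have g2 := theta_le_row hs hr (t := t) (x := x) (y := y) (by rw [← kxy]; omega)
        rw [← e] at g1 g2
        exact ⟨min_le_of_left_le g2, le_max_of_le_right g1⟩
      · obtain ⟨s, hs1, hs2⟩ := kxy.1 h1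
        have g1 := theta_row_le hs hr hs1.le hs2
        have g2 := theta_le_row hs hr (t := t) (x := y) (y := z) (by rw [← kyz]; omega)
        rw [← e] at g1 g2
        exact ⟨min_le_of_right_le g2, le_max_of_le_left g1⟩
  inj x x' y hx hx' hne h0 he := by
    obtain ⟨c, hc⟩ := exists_crossAt_of_theta_ne_zero h0
    obtain ⟨c', hc'⟩ := exists_crossAt_of_theta_ne_zero (he ▸ h0)
    rw [← he] at hc'
    have e := hc.labels_eq hs hr hx
    have e' := hc'.labels_eq hs hr hx'
    have b := hc.2.2.1
    have b' := hc'.2.2.1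
    have := north_injective hs (r := theta n P x y + 1) (by omega) hc.2.1 hc'.2.1 (by omega)
      (by omega) (e.2.trans e'.2.symm)
    subst this
    exact hne (e.1.symm.trans e'.1)

/-! ### Comparing Lehmer tableaux -/

/-- The number of rows below the crossing of `i` and `l` (counted from the top) in which `i` does
not cross a smaller pipe. -/
def turnCount (T : ℕ → ℕ → ℕ) (i l : ℕ) : ℕ :=
  ((Finset.Ico 1 (T i l)).filter fun k => ∀ m, 1 ≤ m → m < i → T m i ≠ k).card

/-- The number of `m < i` that are inverted with `l` but not with `i`. -/
def inversionGap (T : ℕ → ℕ → ℕ) (i l : ℕ) : ℕ :=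
  ((Finset.Ico 1 i).filter fun m => T m i = 0 ∧ T m l ≠ 0).card

theorem card_free_add_card_blocked (f : ℕ → ℕ) (N u : ℕ)
    (hf : ∀ x x', x < N → x' < N → x ≠ x' → f x ≠ 0 → f x ≠ f x') :
    ((Finset.Ico 1 u).filter fun k => ∀ m, 1 ≤ m → m < N → f m ≠ k).card +
      ((Finset.Ico 1 N).filter fun m => f m ≠ 0 ∧ f m < u).card = u - 1 := by
  have h1 : ((Finset.Ico 1 N).filter fun m => f m ≠ 0 ∧ f m < u).card =
      ((Finset.Ico 1 u).filter fun k => ¬ ∀ m, 1 ≤ m → m < N → f m ≠ k).card := by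
    apply Finset.card_bij (fun m _ => f m)
    · intro m hm
      simp only [Finset.mem_filter, Finset.mem_Ico] at hm ⊢
      refine ⟨by omega, fun h => h m (by omega) (by omega) rfl⟩
    · intro m hm m' hm' e
      simp only [Finset.mem_filter, Finset.mem_Ico] at hm hm'
      by_contra hne
      exact hf m m' hm.1.2 hm'.1.2 hne hm.2.1 e
    · intro k hk
      simp only [Finset.mem_filter, Finset.mem_Ico] at hk
      obtain ⟨⟨hk1, hk2⟩, h⟩ := hk
      push Not at h
      obtain ⟨m, hm1, hm2, rfl⟩ := h
      exact ⟨m, by simp only [Finset.mem_filter, Finset.mem_Ico]; omega, rfl⟩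
  rw [h1, Finset.card_filter_add_card_filter_not, Nat.card_Ico]

theorem lehmer_add_inversionGap {T : ℕ → ℕ → ℕ} (hT : IsBalancedColInj T) {i l : ℕ} (hil : i < l)
    (h : T i l ≠ 0) : lehmer T i l + inversionGap T i l = turnCount T i l := by
  have h1 := card_free_add_card_blocked (fun m => T m l) i (T i l)
    (fun x x' hx hx' => hT.inj x x' l (by omega) (by omega))
  have h2 := card_free_add_card_blocked (fun m => T m i) i (T i l)
    (fun x x' hx hx' => hT.inj x x' i (by omega) (by omega))
  have h3 : ((Finset.Ico 1 i).filter fun m => T m l ≠ 0 ∧ T m l < T i l).card =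
      ((Finset.Ico 1 i).filter fun m => T m i ≠ 0 ∧ T m i < T i l).card + inversionGap T i l := by
    rw [inversionGap, ← Finset.card_union_of_disjoint]
    · congr 1
      ext m
      simp only [Finset.mem_filter, Finset.mem_Ico, Finset.mem_union]
      by_cases hm : 1 ≤ m ∧ m < i
      · have hb := hT.balanced m i l hm.2 hil
        have hi := hT.inj i m l hil (by omega) (by omega) h
        rw [LBal, min_le_iff, le_max_iff] at hb
        omega
      · tauto
    · rw [Finset.disjoint_left]
      intro m hm hm'
      simp only [Finset.mem_filter] at hm hm'
      omega
  simp only [lehmer, turnCount] at *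
  omega

theorem turnCount_lt {T : ℕ → ℕ → ℕ} (hT : IsBalancedColInj T) {i x y : ℕ} (hx : i < x)
    (h0 : T i x ≠ 0) (h : T i x < T i y) : turnCount T i x < turnCount T i y := by
  apply Finset.card_lt_card
  rw [Finset.ssubset_iff_of_subset]
  · refine ⟨T i x, ?_, by simp⟩
    simp only [Finset.mem_filter, Finset.mem_Ico]
    refine ⟨by omega, fun m hm1 hm2 e => ?_⟩
    have hb := hT.balanced m i x hm2 hx
    have hi := hT.inj i m x hx (by omega) (by omega) h0
    rw [LBal, min_le_iff, le_max_iff] at hb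
    omega
  · intro k
    simp only [Finset.mem_filter, Finset.mem_Ico]
    exact fun h' => ⟨by omega, h'.2⟩

theorem turnCount_lt_iff {T : ℕ → ℕ → ℕ} (hT : IsBalancedColInj T) {i x y : ℕ} (hx : i < x)
    (hy : i < y) (h0 : T i x ≠ 0) (h0' : T i y ≠ 0) :
    turnCount T i x < turnCount T i y ↔ T i x < T i y := by
  refine ⟨fun h => ?_, turnCount_lt hT hx h0⟩
  by_contra hc
  rcases (not_lt.1 hc).lt_or_eq with h' | h'
  · have := turnCount_lt hT hy h0' h'
    omega
  · simp [turnCount, h'] at h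

theorem lehmer_split {T : ℕ → ℕ → ℕ} (hT : IsBalancedColInj T) {i k l : ℕ} (hi : 1 ≤ i)
    (hik : i < k) (hkl : k < l) :
    lehmer T i l =
      ((Finset.Ico 1 (T i l)).filter fun r => ∀ m, 1 ≤ m → m < k → T m l ≠ r).card +
        ((Finset.Ico i k).filter fun m => T m l ≠ 0 ∧ T m l < T i l).card := by
  have h1 := card_free_add_card_blocked (fun m => T m l) i (T i l)
    (fun x x' hx hx' => hT.inj x x' l (by omega) (by omega))
  have h2 := card_free_add_card_blocked (fun m => T m l) k (T i l)
    (fun x x' hx hx' => hT.inj x x' l (by omega) (by omega))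
  have h3 : ((Finset.Ico 1 k).filter fun m => T m l ≠ 0 ∧ T m l < T i l).card =
      ((Finset.Ico 1 i).filter fun m => T m l ≠ 0 ∧ T m l < T i l).card +
        ((Finset.Ico i k).filter fun m => T m l ≠ 0 ∧ T m l < T i l).card := by
    rw [← Finset.card_union_of_disjoint, ← Finset.filter_union,
      Finset.Ico_union_Ico_eq_Ico hi hik.le]
    exact Finset.disjoint_filter_filter (Finset.Ico_disjoint_Ico_consecutive 1 i k)
  simp only [lehmer] at *
  omega

/-- If a Lehmer tableau dominates another one strictly in the boxes `(i, k)` and `(k, l)`, then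
under the stated local conditions it also does so in the box `(i, l)`. -/
theorem lehmer_lt_of_lt {T U : ℕ → ℕ → ℕ} (hT : IsBalancedColInj T) (hU : IsBalancedColInj U)
    (hz : ∀ x y, x < y → (T x y = 0 ↔ U x y = 0))
    (hle : ∀ x y, x < y → lehmer T x y ≤ lehmer U x y)
    {i k l : ℕ} (hi : 1 ≤ i) (hik : i < k) (hkl : k < l) (hTik : T i k = T i l)
    (hkl0 : T k l ≠ 0) (hlt : T k l < T i l)
    (hfill : ∀ r, T k l < r → r < T i l → ∃ h, 1 ≤ h ∧ h < k ∧ T h l = r)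
    (hno : ∀ h, i < h → h < k → T i h = T i l → T h l ≠ 0 → ¬ T h l < T i l)
    (h1 : lehmer T i k < lehmer U i k) (h2 : lehmer T k l < lehmer U k l) :
    lehmer T i l < lehmer U i l := by
  have hil := hik.trans hkl
  by_contra hc
  have heq : lehmer U i l = lehmer T i l := le_antisymm (not_lt.1 hc) (hle _ _ hil)
  have gap : ∀ x y, x < y → inversionGap T x y = inversionGap U x y := by
    intro x y hxy
    unfold inversionGap
    congr 1
    apply Finset.filter_congr
    intro m hm
    rw [Finset.mem_Ico] at hm
    rw [hz m x hm.2, Ne, hz m y (by omega)]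
  have hTil0 : T i l ≠ 0 := by omega
  have hUil0 : U i l ≠ 0 := fun h => hTil0 ((hz _ _ hil).2 h)
  have hUik0 : U i k ≠ 0 := fun h => hTil0 (hTik ▸ (hz _ _ hik).2 h)
  have tT : ∀ {x}, i < x → T i x ≠ 0 → _ := fun {x} => lehmer_add_inversionGap hT (i := i) (l := x)
  have tU : ∀ {x}, i < x → U i x ≠ 0 → _ := fun {x} => lehmer_add_inversionGap hU (i := i) (l := x)
  have turnEq : turnCount U i l = turnCount T i l := by
    rw [← tT hil hTil0, ← tU hil hUil0, gap _ _ hil, heq]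
  have turnLe : ∀ x, i < x → T i x ≠ 0 → turnCount T i x ≤ turnCount U i x := by
    intro x hx h0
    rw [← tT hx h0, ← tU hx (fun h => h0 ((hz _ _ hx).2 h)), gap _ _ hx]
    exact Nat.add_le_add_right (hle _ _ hx) _
  have hUlt : U i l < U i k := by
    rw [← turnCount_lt_iff hU hil hik hUil0 hUik0, turnEq, ← tU hik hUik0, ← gap _ _ hik]
    have := tT hik (hTik ▸ hTil0)
    have e : turnCount T i l = turnCount T i k := by simp [turnCount, hTik]
    omega
  have hUkl : U k l < U i l := by
    have hb := hU.balanced i k l hik hkl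
    have hj := hU.inj i k l hil hkl hik.ne hUil0
    rw [LBal, min_le_iff, le_max_iff] at hb
    omega
  have sT := lehmer_split hT hi hik hkl
  have sU := lehmer_split hU hi hik hkl
  have cT : ((Finset.Ico 1 (T i l)).filter fun r => ∀ m, 1 ≤ m → m < k → T m l ≠ r).card ≤
      lehmer T k l + 1 := by
    rw [lehmer]
    refine (Finset.card_le_card ?_).trans (Finset.card_insert_le (T k l) _)
    intro r
    simp only [Finset.mem_filter, Finset.mem_Ico, Finset.mem_insert]
    rintro ⟨hr, hf⟩
    by_cases e : r = T k l
    · exact Or.inl e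
    · refine Or.inr ⟨⟨hr.1, ?_⟩, hf⟩
      by_contra hge
      obtain ⟨h, hh1, hh2, hh3⟩ := hfill r (by omega) hr.2
      exact hf h hh1 hh2 hh3
  have cU : lehmer U k l + 1 ≤
      ((Finset.Ico 1 (U i l)).filter fun r => ∀ m, 1 ≤ m → m < k → U m l ≠ r).card := by
    rw [lehmer, ← Finset.card_insert_of_notMem (a := U k l) (by simp)]
    apply Finset.card_le_card
    intro r
    simp only [Finset.mem_filter, Finset.mem_Ico, Finset.mem_insert]
    rintro (rfl | ⟨hr, hf⟩)
    · have : U k l ≠ 0 := fun h => hkl0 ((hz _ _ hkl).2 h)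
      exact ⟨by omega, fun m hm1 hm2 => (hU.inj k m l hkl (by omega) (by omega) this).symm⟩
    · exact ⟨by omega, hf⟩
  have hex : ∃ h ∈ (Finset.Ico i k).filter fun m => T m l ≠ 0 ∧ T m l < T i l,
      h ∉ (Finset.Ico i k).filter fun m => U m l ≠ 0 ∧ U m l < U i l := by
    by_contra! hcon
    have : Finset.card ((Finset.Ico i k).filter fun m => T m l ≠ 0 ∧ T m l < T i l) ≤
        Finset.card ((Finset.Ico i k).filter fun m => U m l ≠ 0 ∧ U m l < U i l) :=
      Finset.card_le_card hcon
    omega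
  obtain ⟨h, hh, hh'⟩ := hex
  simp only [Finset.mem_filter, Finset.mem_Ico, not_and, not_lt] at hh hh'
  obtain ⟨⟨hh1, hh2⟩, hh3, hh4⟩ := hh
  have hih : i < h := by
    rcases hh1.lt_or_eq with h' | rfl
    · exact h'
    · omega
  have hhl : h < l := by omega
  have g1 := hh' ⟨hh1, hh2⟩ (fun e => hh3 ((hz _ _ hhl).2 e))
  have g2 := hU.inj i h l hil hhl hih.ne hUil0
  have bT := hT.balanced i h l hih hhl
  have bU := hU.balanced i h l hih hhl
  rw [LBal, min_le_iff, le_max_iff] at bT bU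
  have hTih : T i l ≤ T i h := by omega
  have hUih : U i h ≤ U i l := by omega
  have hTih0 : T i h ≠ 0 := by omega
  have hUih0 : U i h ≠ 0 := fun e => hTih0 ((hz _ _ hih).2 e)
  have k1 := turnLe h hih hTih0
  have k2 := turnCount_lt_iff hU hil hih hUil0 hUih0
  have k3 := turnCount_lt_iff hT hil hih hTil0 hTih0
  exact hno h hih hh2 (by omega) hh3 hh4

/-- Effect on a column of a Lehmer tableau of exchanging the entries `a < b` of the column. -/
theorem card_free_swap {f f' : ℕ → ℕ} {N i a b : ℕ} (ha : 1 ≤ a) (hab : a < b) (hi1 : 1 ≤ i)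
    (hf : ∀ x x', x < N → x' < N → x ≠ x' → f x ≠ 0 → f x ≠ f x')
    (hfa : f i = a) (hiN : i < N) (hfb : ∀ x, x < i → f x ≠ b)
    (hfill : ∀ k, a < k → k < b → ∃ h, 1 ≤ h ∧ h < i ∧ f h = k)
    (hf' : ∀ x, x < N → f' x = swap a b (f x)) {x : ℕ} (hx : x < N) :
    ((Finset.Ico 1 (f' x)).filter fun k => ∀ m, 1 ≤ m → m < x → f' m ≠ k).card =
      ((Finset.Ico 1 (f x)).filter fun k => ∀ m, 1 ≤ m → m < x → f m ≠ k).card +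
        if x = i then 1 else 0 := by
  have hne : ∀ y, y < N → y ≠ i → f y ≠ a := fun y hy hyi =>
    hfa ▸ (hf i y hiN hy hyi.symm (by omega)).symm
  have hlow : ∀ y, y < i → f' y = f y := fun y hy => by
    rw [hf' y (by omega), swap_apply_of_ne_of_ne (hne y (by omega) (by omega)) (hfb y hy)]
  rcases lt_trichotomy x i with h | h | h
  · rw [if_neg h.ne, add_zero, hlow x h]
    congr 1
    ext k
    simp only [Finset.mem_filter]
    refine and_congr_right fun _ => forall_congr' fun m => forall_congr' fun _ =>
      forall_congr' fun hm => ?_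
    rw [hlow m (by omega)]
  · subst h
    rw [if_pos rfl, hf' x hx, hfa, swap_apply_left,
      ← Finset.card_insert_of_notMem (a := a) (by simp)]
    congr 1
    ext k
    simp only [Finset.mem_filter, Finset.mem_Ico, Finset.mem_insert]
    constructor
    · rintro ⟨hk, hfr⟩
      by_cases e : k = a
      · exact Or.inl e
      · refine Or.inr ⟨⟨hk.1, ?_⟩, fun m hm1 hm2 => by rw [← hlow m hm2]; exact hfr m hm1 hm2⟩
        by_contra hge
        obtain ⟨h, hh1, hh2, hh3⟩ := hfill k (by omega) hk.2
        exact hfr h hh1 hh2 (by rw [hlow h hh2, hh3])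
    · rintro (rfl | ⟨hk, hfr⟩)
      · exact ⟨⟨ha, hab⟩, fun m _ hm2 => by rw [hlow m hm2]; exact hne m (by omega) (by omega)⟩
      · exact ⟨by omega, fun m hm1 hm2 => by rw [hlow m hm2]; exact hfr m hm1 hm2⟩
  · rw [if_neg h.ne', add_zero]
    by_cases hb : f x = b
    · rw [hf' x hx, hb, swap_apply_right]
      congr 1
      ext k
      simp only [Finset.mem_filter, Finset.mem_Ico]
      constructor
      · rintro ⟨hk, hfr⟩
        refine ⟨by omega, fun m hm1 hm2 e => hfr m hm1 hm2 ?_⟩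
        rw [hf' m (by omega), e, swap_apply_of_ne_of_ne (by omega) (by omega)]
      · rintro ⟨hk, hfr⟩
        have hka : k ≠ a := fun e => hfr i hi1 h (by omega)
        have hk' : k < a := by
          by_contra hge
          obtain ⟨m, hm1, hm2, hm3⟩ := hfill k (by omega) (by omega)
          exact hfr m hm1 (by omega) hm3
        refine ⟨by omega, fun m hm1 hm2 e => hfr m hm1 hm2 ?_⟩
        rw [hf' m (by omega)] at e
        rw [← (swap a b).injective.eq_iff, e, swap_apply_of_ne_of_ne (by omega) (by omega)]
    · have hxa := hne x hx h.ne'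
      have hxab : ¬ (a < f x ∧ f x < b) := by
        rintro ⟨h1, h2⟩
        obtain ⟨m, hm1, hm2, hm3⟩ := hfill _ h1 h2
        exact hf x m hx (by omega) (by omega) (by omega) hm3.symm
      rw [hf' x hx, swap_apply_of_ne_of_ne hxa hb]
      apply Finset.card_bij (fun k _ => swap a b k)
      · intro k hk
        simp only [Finset.mem_filter, Finset.mem_Ico] at hk ⊢
        constructor
        · rw [swap_apply_def]
          split_ifs <;> omega
        · intro m hm1 hm2 e
          apply hk.2 m hm1 hm2
          rw [hf' m (by omega), e, swap_apply_self]
      · intro k _ k' _ e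
        exact (swap a b).injective e
      · intro k hk
        simp only [Finset.mem_filter, Finset.mem_Ico] at hk
        refine ⟨swap a b k, ?_, swap_apply_self _ _ _⟩
        simp only [Finset.mem_filter, Finset.mem_Ico]
        constructor
        · rw [swap_apply_def]
          split_ifs <;> omega
        · intro m hm1 hm2 e
          apply hk.2 m hm1 hm2
          rw [hf' m (by omega)] at e
          exact (swap a b).injective e

end PipeDream

namespace PipeDream

open Equiv

variable {n : ℕ} {P : ℕ → ℕ → Bool} {a b c d : ℕ}

theorem crossAt_of_cross (hs : Supported n P) {r y : ℕ} (hP : P r y = true) :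
    CrossAt n P r y (westLabel n P r y) (northLabel n P (r + 1) y) :=
  have hb := hs _ _ hP
  ⟨hb.1, hb.2.1, hb.2.2, hP, Or.inl ⟨rfl, rfl⟩⟩

theorem west_lt_south (hs : Supported n P) (hr : Reduced n P) {r y : ℕ} (hP : P r y = true) :
    westLabel n P r y < northLabel n P (r + 1) y := by
  have hc := crossAt_of_cross hs hP
  by_contra hle
  have hne := hc.ne hs
  have := hc.symm.labels_eq hs hr (by omega)
  omega

theorem theta_comm (hr : Reduced n P) (x y : ℕ) : theta n P x y = theta n P y x := by
  by_cases h : theta n P y x = 0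
  · by_contra hne
    rw [h] at hne
    obtain ⟨c, hc⟩ := exists_crossAt_of_theta_ne_zero hne
    exact hne (by rw [← theta_eq_of_crossAt hr hc.symm, h])
  · obtain ⟨c, hc⟩ := exists_crossAt_of_theta_ne_zero h
    exact theta_eq_of_crossAt hr hc.symm

end PipeDream

/-! ### Pipes through a chute rectangle -/

namespace IsChuteRect

open PipeDream Equiv

variable {n : ℕ} {P : ℕ → ℕ → Bool} {a b c d : ℕ}

theorem one_le_row (R : IsChuteRect n P a b c d) : 1 ≤ a := R.1

theorem row_lt (R : IsChuteRect n P a b c d) : a < b := R.2.1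

theorem one_le_col (R : IsChuteRect n P a b c d) : 1 ≤ c := R.2.2.1

theorem col_lt (R : IsChuteRect n P a b c d) : c < d := R.2.2.2.1

theorem le_bound (R : IsChuteRect n P a b c d) : b + d ≤ n + 1 := R.2.2.2.2.1

theorem nw (R : IsChuteRect n P a b c d) : P a c = false := R.2.2.2.2.2.1

theorem sw (R : IsChuteRect n P a b c d) : P b c = false := R.2.2.2.2.2.2.1

theorem se (R : IsChuteRect n P a b c d) : P b d = false := R.2.2.2.2.2.2.2.1

theorem cross (R : IsChuteRect n P a b c d) {r y : ℕ} (h1 : a ≤ r) (h2 : r ≤ b) (h3 : c ≤ y)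
    (h4 : y ≤ d) (h5 : ¬(r = a ∧ y = c)) (h6 : ¬(r = b ∧ y = c)) (h7 : ¬(r = b ∧ y = d)) :
    P r y = true := R.2.2.2.2.2.2.2.2 r y h1 h2 h3 h4 h5 h6 h7

theorem north_col (R : IsChuteRect n P a b c d) {r : ℕ} (h1 : a < r) (h2 : r ≤ b) :
    northLabel n P r c = westLabel n P b c := by
  obtain ⟨s, rfl⟩ := Nat.exists_eq_add_of_le h2
  induction s generalizing r with
  | zero => exact north_of_bump R.sw
  | succ s ih =>
    have := R.le_bound
    have := R.col_lt
    rw [north_of_cross (by omega) (R.cross (by omega) (by omega) le_rfl (by omega) (by omega)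
      (by omega) (by omega))]
    have e : r + (s + 1) = r + 1 + s := by omega
    rw [e] at R ⊢
    exact ih (by omega) R (by omega)

theorem west_bot (R : IsChuteRect n P a b c d) {y : ℕ} (h1 : c < y) (h2 : y ≤ d) :
    westLabel n P b y = northLabel n P (b + 1) c := by
  have := R.le_bound
  have := R.one_le_col
  have := R.row_lt
  induction y, h1 using Nat.le_induction with
  | base => exact west_succ_of_bump (by omega) (by omega) R.sw
  | succ y hy ih =>
    rw [west_succ_of_cross (by omega) (by omega) (R.cross (by omega) (by omega) (by omega)
      (by omega) (by omega) (by omega) (by omega)), ih (by omega)]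

theorem west_top (R : IsChuteRect n P a b c d) {y : ℕ} (h1 : c < y) (h2 : y ≤ d) :
    westLabel n P a y = westLabel n P b c := by
  have := R.le_bound
  have := R.one_le_col
  have := R.row_lt
  induction y, h1 using Nat.le_induction with
  | base => rw [west_succ_of_bump (by omega) (by omega) R.nw, R.north_col (by omega) (by omega)]
  | succ y hy ih =>
    rw [west_succ_of_cross (by omega) (by omega) (R.cross (by omega) (by omega) (by omega)
      (by omega) (by omega) (by omega) (by omega)), ih (by omega)]

theorem west_mid (R : IsChuteRect n P a b c d) {r y : ℕ} (h1 : a < r) (h2 : r < b) (h3 : c ≤ y)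
    (h4 : y ≤ d) : westLabel n P r y = westLabel n P r c := by
  have := R.le_bound
  have := R.one_le_col
  induction y, h3 using Nat.le_induction with
  | base => rfl
  | succ y hy ih =>
    rw [west_succ_of_cross (by omega) (by omega) (R.cross (by omega) (by omega) (by omega)
      (by omega) (by omega) (by omega) (by omega)), ih (by omega)]

theorem north_mid (R : IsChuteRect n P a b c d) {r y : ℕ} (h1 : a ≤ r) (h2 : r ≤ b) (h3 : c < y)
    (h4 : y ≤ d) : northLabel n P r y = northLabel n P a y := by
  have := R.le_bound
  induction r, h1 using Nat.le_induction with
  | base => rfl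
  | succ r hr ih =>
    rw [← north_of_cross (by omega) (R.cross (by omega) (by omega) (by omega)
      (by omega) (by omega) (by omega) (by omega)), ih (by omega)]

theorem north_right (R : IsChuteRect n P a b c d) :
    northLabel n P a d = northLabel n P (b + 1) c := by
  rw [← R.north_mid R.row_lt.le le_rfl R.col_lt le_rfl, north_of_bump R.se,
    R.west_bot R.col_lt le_rfl]

theorem south_mid (R : IsChuteRect n P a b c d) {y : ℕ} (h3 : c < y) (h4 : y < d) :
    northLabel n P (b + 1) y = northLabel n P a y := by
  have := R.le_bound
  have := R.row_lt
  rw [← R.north_mid (r := b) (by omega) le_rfl h3 h4.le, north_of_cross (r := b) (by omega)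
    (R.cross (by omega) (by omega) (by omega) (by omega) (by omega) (by omega) (by omega))]

theorem crossAt_top (hs : Supported n P) (R : IsChuteRect n P a b c d) {y : ℕ} (h1 : c < y)
    (h2 : y ≤ d) : CrossAt n P a y (westLabel n P b c) (northLabel n P a y) := by
  have := R.row_lt
  have := crossAt_of_cross hs (R.cross (r := a) (y := y) (by omega) (by omega) (by omega) h2
    (by omega) (by omega) (by omega))
  rwa [R.west_top h1 h2, R.north_mid (by omega) (by omega) h1 h2] at this

theorem crossAt_bot (hs : Supported n P) (R : IsChuteRect n P a b c d) {y : ℕ} (h1 : c < y)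
    (h2 : y < d) : CrossAt n P b y (northLabel n P (b + 1) c) (northLabel n P a y) := by
  have := R.row_lt
  have := crossAt_of_cross hs (R.cross (r := b) (y := y) (by omega) (by omega) (by omega) h2.le
    (by omega) (by omega) (by omega))
  rwa [R.west_bot h1 h2.le, R.south_mid h1 h2] at this

theorem crossAt_left (hs : Supported n P) (R : IsChuteRect n P a b c d) {r : ℕ} (h1 : a < r)
    (h2 : r < b) : CrossAt n P r c (westLabel n P r c) (westLabel n P b c) := by
  have := R.col_lt
  have := crossAt_of_cross hs (R.cross (r := r) (y := c) (by omega) (by omega) (by omega)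
    (by omega) (by omega) (by omega) (by omega))
  rwa [R.north_col (by omega) (by omega)] at this

theorem crossAt_mid (hs : Supported n P) (R : IsChuteRect n P a b c d) {r y : ℕ} (h1 : a < r)
    (h2 : r < b) (h3 : c < y) (h4 : y ≤ d) :
    CrossAt n P r y (westLabel n P r c) (northLabel n P a y) := by
  have := crossAt_of_cross hs (R.cross (r := r) (y := y) (by omega) (by omega) (by omega)
    (by omega) (by omega) (by omega) (by omega))
  rwa [R.west_mid h1 h2 h3.le h4, R.north_mid (by omega) (by omega) h3 h4] at this

theorem left_lt_top (hs : Supported n P) (hr : Reduced n P) (R : IsChuteRect n P a b c d) {y : ℕ}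
    (h1 : c < y) (h2 : y ≤ d) : westLabel n P b c < northLabel n P a y := by
  have := R.row_lt
  have := west_lt_south hs hr (R.cross (r := a) (y := y) (by omega) (by omega) (by omega) h2
    (by omega) (by omega) (by omega))
  rwa [R.west_top h1 h2, R.north_mid (by omega) (by omega) h1 h2] at this

theorem left_lt_south (hs : Supported n P) (hr : Reduced n P) (R : IsChuteRect n P a b c d) :
    westLabel n P b c < northLabel n P (b + 1) c := by
  rw [← R.north_right]
  exact R.left_lt_top hs hr R.col_lt le_rfl

theorem south_lt_top (hs : Supported n P) (hr : Reduced n P) (R : IsChuteRect n P a b c d) {y : ℕ}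
    (h1 : c < y) (h2 : y < d) : northLabel n P (b + 1) c < northLabel n P a y := by
  have := R.row_lt
  have := west_lt_south hs hr (R.cross (r := b) (y := y) (by omega) (by omega) (by omega) h2.le
    (by omega) (by omega) (by omega))
  rwa [R.west_bot h1 h2.le, R.south_mid h1 h2] at this

theorem mid_lt_left (hs : Supported n P) (hr : Reduced n P) (R : IsChuteRect n P a b c d) {r : ℕ}
    (h1 : a < r) (h2 : r < b) : westLabel n P r c < westLabel n P b c := by
  have := R.col_lt
  have := west_lt_south hs hr (R.cross (r := r) (y := c) (by omega) (by omega) (by omega)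
    (by omega) (by omega) (by omega) (by omega))
  rwa [R.north_col (by omega) (by omega)] at this

theorem time_lt (R : IsChuteRect n P a b c d) : boxTime n b c < boxTime n a d := by
  have := R.le_bound
  have := R.one_le_col
  have := R.col_lt
  have := R.row_lt
  have := R.one_le_row
  rw [boxTime_lt_iff] <;> omega

/-- Crossings of the left pipe of the rectangle between the times of the two exchanged boxes. -/
theorem crossTime_left (hs : Supported n P) (R : IsChuteRect n P a b c d) {t x : ℕ}
    (h1 : boxTime n b c < t) (h2 : t < boxTime n a d)
    (h : CrossTime n P t (westLabel n P b c) x) :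
    (∃ r, a < r ∧ r < b ∧ x = westLabel n P r c) ∨ ∃ y, c < y ∧ y < d ∧ x = northLabel n P a y := by
  obtain ⟨e, hc⟩ := h.exists_box hs
  generalize n - t / n = r at *
  generalize t % n + 1 = y at *
  subst e
  have e1 := R.le_bound
  have e2 := R.one_le_col
  have e3 := R.col_lt
  have e4 := R.row_lt
  have e5 := R.one_le_row
  obtain ⟨f1, f2, f3, hP, hl⟩ := hc
  rw [boxTime_lt_iff (by omega) (by omega) (by omega) (by omega) (by omega) (by omega)] at h1 h2
  rcases (show r = b ∧ c < y ∨ (a < r ∧ r < b) ∨ r = a ∧ y < d by omega) with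
    ⟨rfl, hy⟩ | ⟨hr1, hr2⟩ | ⟨rfl, hy⟩
  · rcases hl with hl | hl
    · have := west_ne_north hs f1 e2 hy (by omega)
      rw [R.north_col (by omega) le_rfl] at this
      exact absurd hl.1 this
    · exact absurd hl.2.symm (west_ne_south hs f1 e2 hy.le f3)
  · left
    have hN := R.north_col (r := r) (by omega) (by omega)
    have hN' := R.north_col (r := r + 1) (by omega) (by omega)
    rcases hl with hl | hl
    · rcases lt_or_ge c y with hy | hy
      · exact absurd (hl.1.trans hN.symm) (west_ne_north hs f1 e2 hy (by omega))
      · exact absurd (hl.1.trans hN'.symm) (west_ne_south hs f1 f2 hy (by omega))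
    · have := north_injective hs (by omega) f2 e2 (by omega) (by omega) (hl.2.trans hN'.symm)
      subst this
      exact ⟨r, hr1, hr2, hl.1.symm⟩
  · right
    have hN' := R.north_col (r := r + 1) (by omega) (by omega)
    rcases hl with hl | hl
    · rcases lt_or_ge c y with hy' | hy'
      · refine ⟨y, hy', hy, ?_⟩
        rw [← hl.2, southLabel, ← R.north_mid (r := r + 1) (by omega) (by omega) hy' hy.le]
        rfl
      · exact absurd (hl.1.trans hN'.symm) (west_ne_south hs f1 f2 hy' (by omega))
    · have := north_injective hs (by omega) f2 e2 (by omega) (by omega) (hl.2.trans hN'.symm)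
      subst this
      rw [R.nw] at hP
      exact absurd hP (by simp)

/-- Crossings of the right pipe of the rectangle between the times of the two exchanged boxes. -/
theorem crossTime_right (hs : Supported n P) (R : IsChuteRect n P a b c d) {t x : ℕ}
    (h1 : boxTime n b c < t) (h2 : t < boxTime n a d)
    (h : CrossTime n P t (northLabel n P (b + 1) c) x) :
    (∃ r, a < r ∧ r < b ∧ x = westLabel n P r c) ∨ ∃ y, c < y ∧ y < d ∧ x = northLabel n P a y := by
  obtain ⟨e, hc⟩ := h.exists_box hs
  generalize n - t / n = r at *
  generalize t % n + 1 = y at *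
  subst e
  have e1 := R.le_bound
  have e2 := R.one_le_col
  have e3 := R.col_lt
  have e4 := R.row_lt
  have e5 := R.one_le_row
  obtain ⟨f1, f2, f3, hP, hl⟩ := hc
  have hN : ∀ s, a ≤ s → s ≤ b → northLabel n P s d = northLabel n P (b + 1) c :=
    fun s h h' => (R.north_mid h h' e3 le_rfl).trans R.north_right
  rw [boxTime_lt_iff (by omega) (by omega) (by omega) (by omega) (by omega) (by omega)] at h1 h2
  rcases (show r = b ∧ c < y ∨ (a < r ∧ r < b) ∨ r = a ∧ y < d by omega) with
    ⟨rfl, hy⟩ | ⟨hr1, hr2⟩ | ⟨rfl, hy⟩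
  · right
    rcases hl with hl | hl
    · rcases lt_trichotomy y d with h' | rfl | h'
      · exact ⟨y, hy, h', hl.2.symm.trans (R.south_mid hy h')⟩
      · rw [R.se] at hP
        exact absurd hP (by simp)
      · exact absurd (hl.1.trans (hN r (by omega) le_rfl).symm)
          (west_ne_north hs f1 (by omega) h' (by omega))
    · have := north_injective hs (by omega) f2 e2 (by omega) (by omega) hl.2
      omega
  · left
    rcases hl with hl | hl
    · rcases lt_or_ge d y with hy | hy
      · exact absurd (hl.1.trans (hN r (by omega) (by omega)).symm)
          (west_ne_north hs f1 (by omega) hy (by omega))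
      · exact absurd (hl.1.trans (hN (r + 1) (by omega) (by omega)).symm)
          (west_ne_south hs f1 f2 hy (by omega))
    · have := north_injective hs (by omega) f2 (show 1 ≤ d by omega) (by omega) (by omega)
        (hl.2.trans (hN (r + 1) (by omega) (by omega)).symm)
      subst this
      exact ⟨r, hr1, hr2, hl.1.symm.trans (R.west_mid hr1 hr2 e3.le le_rfl)⟩
  · rcases hl with hl | hl
    · exact absurd (hl.1.trans (hN (r + 1) (by omega) (by omega)).symm)
          (west_ne_south hs f1 f2 hy.le (by omega))
    · have := north_injective hs (by omega) f2 (show 1 ≤ d by omega) (by omega) (by omega)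
        (hl.2.trans (hN (r + 1) (by omega) (by omega)).symm)
      omega

end IsChuteRect

/-! ### The effect of a chute move -/

namespace IsChuteRect

open PipeDream Equiv

variable {n : ℕ} {P : ℕ → ℕ → Bool} {a b c d : ℕ}

theorem supported_chuteResult (hs : Supported n P) (R : IsChuteRect n P a b c d) :
    Supported n (chuteResult P a b c d) := by
  intro r y h
  have e1 := R.le_bound
  have e2 := R.one_le_col
  have e3 := R.col_lt
  have e4 := R.row_lt
  rw [chuteResult] at h
  split_ifs at h with h1
  · omega
  · exact hs r y h

theorem time_eq (R : IsChuteRect n P a b c d) {t : ℕ} :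
    (n - t / n = b ∧ t % n + 1 = c ↔ t = boxTime n b c) ∧
      (n - t / n = a ∧ t % n + 1 = d ↔ t = boxTime n a d) := by
  have e1 := R.le_bound
  have e2 := R.one_le_col
  have e3 := R.col_lt
  have e4 := R.row_lt
  have e5 := R.one_le_row
  have key : ∀ r y, 1 ≤ r → r ≤ n → 1 ≤ y → y ≤ n →
      (n - t / n = r ∧ t % n + 1 = y ↔ t = boxTime n r y) := by
    intro r y hr hrn hy hyn
    constructor
    · rintro ⟨rfl, rfl⟩
      rw [boxTime, show n - (n - t / n) = t / n by omega, Nat.add_sub_cancel, mul_comm,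
        Nat.div_add_mod]
    · rintro rfl
      rw [boxTime_div hy hyn, boxTime_mod hy hyn]
      omega
  exact ⟨key b c (by omega) (by omega) (by omega) (by omega),
    key a d (by omega) (by omega) (by omega) (by omega)⟩

theorem chuteResult_time (R : IsChuteRect n P a b c d) (t : ℕ) :
    chuteResult P a b c d (n - t / n) (t % n + 1) =
      if t = boxTime n b c then true else if t = boxTime n a d then false
        else P (n - t / n) (t % n + 1) := by
  rw [chuteResult]
  simp only [R.time_eq.1, R.time_eq.2]

theorem state_sw (hs : Supported n P) (R : IsChuteRect n P a b c d) :
    state n P (boxTime n b c) (b + c - 1) = westLabel n P b c ∧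
      state n P (boxTime n b c) (b + c) = northLabel n P (b + 1) c := by
  have e1 := R.le_bound
  have e2 := R.one_le_col
  have e3 := R.col_lt
  have e4 := R.row_lt
  exact ⟨state_west hs (by omega) e2 (by omega), state_south hs (by omega) e2 le_rfl (by omega)⟩

theorem state_ne (hs : Supported n P) (R : IsChuteRect n P a b c d) :
    state n P (boxTime n a d) (a + d - 1) = westLabel n P b c ∧
      state n P (boxTime n a d) (a + d) = northLabel n P (b + 1) c := by
  have e1 := R.le_bound
  have e2 := R.one_le_col
  have e3 := R.col_lt
  have e4 := R.row_lt
  have e5 := R.one_le_row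
  rw [state_west hs e5 (by omega) (by omega), state_south hs e5 (by omega) le_rfl (by omega),
    R.west_top e3 le_rfl, R.north_mid (by omega) (by omega) e3 le_rfl, R.north_right]
  exact ⟨rfl, rfl⟩

theorem state_chuteResult_le (R : IsChuteRect n P a b c d) {t : ℕ} (ht : t ≤ boxTime n b c) :
    state n (chuteResult P a b c d) t = state n P t := by
  have := R.time_lt
  induction t with
  | zero => rfl
  | succ t ih =>
    rw [state, state, ih (by omega), R.chuteResult_time, if_neg (show ¬t = boxTime n b c by omega),
      if_neg (show ¬t = boxTime n a d by omega)]

theorem state_chuteResult_mid (hs : Supported n P) (R : IsChuteRect n P a b c d) {t : ℕ}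
    (ht : boxTime n b c < t) (ht' : t ≤ boxTime n a d) :
    state n (chuteResult P a b c d) t =
      swap (westLabel n P b c) (northLabel n P (b + 1) c) * state n P t := by
  induction t, ht using Nat.le_induction with
  | base =>
    have e1 := R.le_bound
    have e2 := R.one_le_col
    have e3 := R.col_lt
    rw [state_succ_boxTime (by omega) (by omega) (by omega),
      state_succ_boxTime (by omega) (by omega) (by omega), R.state_chuteResult_le le_rfl, R.sw]
    simp only [chuteResult, and_self, if_true]
    rw [mul_swap_eq_swap_mul, (R.state_sw hs).1, (R.state_sw hs).2]
    simp
  | succ t h ih =>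
    rw [state, state, ih (by omega), R.chuteResult_time, if_neg (show ¬t = boxTime n b c by omega),
      if_neg (show ¬t = boxTime n a d by omega),
      mul_assoc]

theorem state_chuteResult_gt (hs : Supported n P) (R : IsChuteRect n P a b c d) {t : ℕ}
    (ht : boxTime n a d < t) : state n (chuteResult P a b c d) t = state n P t := by
  have e3 := R.col_lt
  have e4 := R.row_lt
  have e5 := R.time_lt
  have e6 := R.cross (r := a) (y := d) le_rfl e4.le e3.le le_rfl (by omega) (by omega) (by omega)
  induction t, ht using Nat.le_induction with
  | base =>
    have e1 := R.le_bound
    have e2 := R.one_le_col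
    rw [state_succ_boxTime (by omega) (by omega) (by omega),
      state_succ_boxTime (by omega) (by omega) (by omega), R.state_chuteResult_mid hs e5 le_rfl, e6]
    simp only [chuteResult, e4.ne, and_self, false_and, if_true, if_false]
    rw [mul_swap_eq_swap_mul, (R.state_ne hs).1, (R.state_ne hs).2]
    simp
  | succ t h ih =>
    rw [state, state, ih, R.chuteResult_time, if_neg (show ¬t = boxTime n b c by omega),
      if_neg (show ¬t = boxTime n a d by omega)]

theorem crossTime_chuteResult_out (hs : Supported n P) (R : IsChuteRect n P a b c d) {t x y : ℕ}
    (ht : t < boxTime n b c ∨ boxTime n a d < t) :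
    CrossTime n (chuteResult P a b c d) t x y ↔ CrossTime n P t x y := by
  have := R.time_lt
  rw [CrossTime, CrossTime, R.chuteResult_time, if_neg (by omega), if_neg (by omega)]
  rcases ht with ht | ht
  · rw [R.state_chuteResult_le ht.le]
  · rw [R.state_chuteResult_gt hs ht]

theorem crossTime_chuteResult_mid (hs : Supported n P) (R : IsChuteRect n P a b c d) {t x y : ℕ}
    (ht : boxTime n b c < t) (ht' : t < boxTime n a d) :
    CrossTime n (chuteResult P a b c d) t x y ↔
      CrossTime n P t (swap (westLabel n P b c) (northLabel n P (b + 1) c) x)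
        (swap (westLabel n P b c) (northLabel n P (b + 1) c) y) := by
  rw [CrossTime, CrossTime, R.chuteResult_time, if_neg (by omega), if_neg (by omega),
    R.state_chuteResult_mid hs ht ht'.le]
  simp only [Perm.mul_apply, swap_apply_eq_iff]

theorem crossTime_chuteResult_sw (hs : Supported n P) (R : IsChuteRect n P a b c d) {x y : ℕ} :
    CrossTime n (chuteResult P a b c d) (boxTime n b c) x y ↔
      (westLabel n P b c = x ∧ northLabel n P (b + 1) c = y) ∨
        (westLabel n P b c = y ∧ northLabel n P (b + 1) c = x) := by
  have e1 := R.le_bound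
  have e2 := R.one_le_col
  have e3 := R.col_lt
  rw [CrossTime, R.chuteResult_time, if_pos rfl, R.state_chuteResult_le le_rfl,
    boxTime_div e2 (by omega), boxTime_mod e2 (by omega), show n - (n - b) = b by omega,
    show b + (c - 1) = b + c - 1 by omega, show b + c - 1 + 1 = b + c by omega,
    (R.state_sw hs).1, (R.state_sw hs).2]
  simp

theorem not_crossTime_chuteResult_ne (R : IsChuteRect n P a b c d) {x y : ℕ} :
    ¬ CrossTime n (chuteResult P a b c d) (boxTime n a d) x y := by
  have := R.time_lt
  rw [CrossTime, R.chuteResult_time, if_neg (by omega), if_pos rfl]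
  simp

theorem crossTime_ne (hs : Supported n P) (R : IsChuteRect n P a b c d) :
    CrossTime n P (boxTime n a d) (westLabel n P b c) (northLabel n P (b + 1) c) := by
  rw [← R.north_right]
  exact (R.crossAt_top hs R.col_lt le_rfl).crossTime hs

/-- Times strictly between those of the two exchanged boxes. -/
theorem time_mem (R : IsChuteRect n P a b c d) {r y : ℕ} (h1 : a ≤ r) (h2 : r ≤ b) (h3 : c ≤ y)
    (h4 : y ≤ d) (h5 : r = a → y < d) (h6 : r = b → c < y) :
    boxTime n b c < boxTime n r y ∧ boxTime n r y < boxTime n a d := by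
  have e1 := R.le_bound
  have e2 := R.one_le_col
  have e3 := R.col_lt
  have e4 := R.row_lt
  have e5 := R.one_le_row
  constructor <;> rw [boxTime_lt_iff] <;> omega

theorem exists_crossTime_swap (hs : Supported n P) (R : IsChuteRect n P a b c d) {x : ℕ} :
    (∃ t, boxTime n b c < t ∧ t < boxTime n a d ∧ CrossTime n P t (westLabel n P b c) x) ↔
      ∃ t, boxTime n b c < t ∧ t < boxTime n a d ∧ CrossTime n P t (northLabel n P (b + 1) c) x := by
  have e3 := R.col_lt
  have e4 := R.row_lt
  have h : (∃ r, a < r ∧ r < b ∧ x = westLabel n P r c) ∨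
      (∃ y, c < y ∧ y < d ∧ x = northLabel n P a y) →
      (∃ t, boxTime n b c < t ∧ t < boxTime n a d ∧ CrossTime n P t (westLabel n P b c) x) ∧
      ∃ t, boxTime n b c < t ∧ t < boxTime n a d ∧
        CrossTime n P t (northLabel n P (b + 1) c) x := by
    rintro (⟨r, h1, h2, rfl⟩ | ⟨y, h1, h2, rfl⟩)
    · obtain ⟨f1, f2⟩ := R.time_mem (r := r) (y := c) (by omega) (by omega) le_rfl (by omega)
        (by omega) (by omega)
      obtain ⟨f3, f4⟩ := R.time_mem (r := r) (y := d) (by omega) (by omega) (by omega) le_rfl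
        (by omega) (by omega)
      refine ⟨⟨_, f1, f2, ((R.crossAt_left hs h1 h2).crossTime hs).symm⟩, _, f3, f4, ?_⟩
      have := ((R.crossAt_mid hs h1 h2 e3 le_rfl).crossTime hs).symm
      rwa [R.north_right] at this
    · obtain ⟨f1, f2⟩ := R.time_mem (r := a) (y := y) (by omega) (by omega) (by omega) (by omega)
        (by omega) (by omega)
      obtain ⟨f3, f4⟩ := R.time_mem (r := b) (y := y) (by omega) (by omega) (by omega) (by omega)
        (by omega) (by omega)
      exact ⟨⟨_, f1, f2, (R.crossAt_top hs h1 h2.le).crossTime hs⟩, _, f3, f4,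
        (R.crossAt_bot hs h1 h2).crossTime hs⟩
  constructor
  · rintro ⟨t, h1, h2, h3⟩
    exact (h (R.crossTime_left hs h1 h2 h3)).2
  · rintro ⟨t, h1, h2, h3⟩
    exact (h (R.crossTime_right hs h1 h2 h3)).1

theorem timeReduced_chuteResult (hs : Supported n P) (ht : TimeReduced n P)
    (R : IsChuteRect n P a b c d) : TimeReduced n (chuteResult P a b c d) := by
  set i := westLabel n P b c with hi
  set j := northLabel n P (b + 1) c with hj
  have hij := R.crossTime_ne hs
  have htl := R.time_lt
  have hex := fun x => R.exists_crossTime_swap hs (x := x)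
  rw [← hi, ← hj] at hij
  simp only [← hi, ← hj] at hex
  have key : ∀ x y t, CrossTime n P t x y → boxTime n b c < t → t < boxTime n a d →
      (x = i → y = j → False) ∧ (x = j → y = i → False) := by
    intro x y t h h1 h2
    constructor
    · rintro rfl rfl
      exact absurd (ht _ _ _ _ h hij) (by omega)
    · rintro rfl rfl
      exact absurd (ht _ _ _ _ h.symm hij) (by omega)
  have mixed : ∀ x y t t', boxTime n b c < t → t < boxTime n a d →
      CrossTime n P t (swap i j x) (swap i j y) → CrossTime n P t' x y →
      (t' < boxTime n b c ∨ boxTime n a d < t') → False := by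
    intro x y t t' h1 h2 h h' ho
    have k := key _ _ _ h h1 h2
    rw [swap_apply_eq_iff, swap_apply_left, swap_apply_eq_iff, swap_apply_right,
      swap_apply_eq_iff, swap_apply_eq_iff, swap_apply_left, swap_apply_right] at k
    have one : ∀ x y, CrossTime n P t (swap i j x) (swap i j y) → CrossTime n P t' x y →
        y ≠ i → y ≠ j → False := by
      intro x y h h' hy1 hy2
      rw [swap_apply_of_ne_of_ne hy1 hy2] at h
      by_cases hxi : x = i
      · rw [hxi, swap_apply_left] at h
        obtain ⟨s, g1, g2, g3⟩ := (hex y).2 ⟨t, h1, h2, h⟩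
        exact absurd (ht _ _ _ _ g3 (hxi ▸ h')) (by omega)
      by_cases hxj : x = j
      · rw [hxj, swap_apply_right] at h
        obtain ⟨s, g1, g2, g3⟩ := (hex y).1 ⟨t, h1, h2, h⟩
        exact absurd (ht _ _ _ _ g3 (hxj ▸ h')) (by omega)
      rw [swap_apply_of_ne_of_ne hxi hxj] at h
      exact absurd (ht _ _ _ _ h h') (by omega)
    have hne := h'.ne
    by_cases hy : y ≠ i ∧ y ≠ j
    · exact one x y h h' hy.1 hy.2
    · refine one y x h.symm h'.symm ?_ ?_
      · rintro rfl
        exact hy ⟨fun e => hne e.symm, fun e => k.2 rfl e⟩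
      · rintro rfl
        exact hy ⟨fun e => k.1 rfl e, fun e => hne e.symm⟩
  have main : ∀ x y t t', t < t' → CrossTime n (chuteResult P a b c d) t x y →
      CrossTime n (chuteResult P a b c d) t' x y → False := by
    intro x y t t' hlt h h'
    have hn : ∀ s, CrossTime n (chuteResult P a b c d) s x y → s ≠ boxTime n a d := by
      rintro s g rfl
      exact R.not_crossTime_chuteResult_ne g
    have hsw : ∀ s, CrossTime n (chuteResult P a b c d) s x y → s ≠ boxTime n b c →
        CrossTime n (chuteResult P a b c d) (boxTime n b c) x y → False := by
      intro s g hsn g'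
      have hs' := hn s g
      rw [R.crossTime_chuteResult_sw hs] at g'
      have hc : CrossTime n P s i j := by
        by_cases hm : boxTime n b c < s ∧ s < boxTime n a d
        · rw [R.crossTime_chuteResult_mid hs hm.1 hm.2] at g
          rcases g' with ⟨rfl, rfl⟩ | ⟨rfl, rfl⟩
          · simpa using g.symm
          · simpa using g
        · rw [R.crossTime_chuteResult_out hs (by omega)] at g
          rcases g' with ⟨rfl, rfl⟩ | ⟨rfl, rfl⟩
          · exact g
          · exact g.symm
      exact hs' (ht _ _ _ _ hc hij)
    have hn1 := hn t h
    have hn2 := hn t' h'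
    by_cases ht1 : t = boxTime n b c
    · exact hsw t' h' (by omega) (ht1 ▸ h)
    by_cases ht2 : t' = boxTime n b c
    · exact hsw t h (by omega) (ht2 ▸ h')
    by_cases hm1 : boxTime n b c < t ∧ t < boxTime n a d <;>
    by_cases hm2 : boxTime n b c < t' ∧ t' < boxTime n a d
    · rw [R.crossTime_chuteResult_mid hs hm1.1 hm1.2] at h
      rw [R.crossTime_chuteResult_mid hs hm2.1 hm2.2] at h'
      exact absurd (ht _ _ _ _ h h') (by omega)
    · rw [R.crossTime_chuteResult_mid hs hm1.1 hm1.2] at h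
      rw [R.crossTime_chuteResult_out hs (by omega)] at h'
      exact mixed _ _ _ _ hm1.1 hm1.2 h h' (by omega)
    · rw [R.crossTime_chuteResult_mid hs hm2.1 hm2.2] at h'
      rw [R.crossTime_chuteResult_out hs (by omega)] at h
      exact mixed _ _ _ _ hm2.1 hm2.2 h' h (by omega)
    · rw [R.crossTime_chuteResult_out hs (by omega)] at h h'
      exact absurd (ht _ _ _ _ h h') (by omega)
  intro x y t t' h h'
  rcases lt_trichotomy t t' with hlt | rfl | hlt
  · exact (main _ _ _ _ hlt h h').elim
  · rfl
  · exact (main _ _ _ _ hlt h' h).elim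

theorem reduced_chuteResult (hs : Supported n P) (hr : Reduced n P)
    (R : IsChuteRect n P a b c d) : Reduced n (chuteResult P a b c d) :=
  (reduced_iff_timeReduced (R.supported_chuteResult hs)).2
    (R.timeReduced_chuteResult hs ((reduced_iff_timeReduced hs).1 hr))

theorem northLabel_one_chuteResult (hs : Supported n P) (R : IsChuteRect n P a b c d) {y : ℕ}
    (h1 : 1 ≤ y) (hy : y ≤ n) :
    northLabel n (chuteResult P a b c d) 1 y = northLabel n P 1 y := by
  have e1 := R.le_bound
  have e2 := R.one_le_col
  have e3 := R.col_lt
  have e4 := R.row_lt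
  have e5 := R.one_le_row
  rw [← state_row_end (R.supported_chuteResult hs) le_rfl h1 (by omega),
    ← state_row_end hs le_rfl h1 (by omega), R.state_chuteResult_gt hs]
  rw [Nat.lt_succ_iff]
  by_contra hlt
  rw [not_le, boxTime_lt_iff] at hlt <;> omega

end IsChuteRect

namespace PipeDream

theorem theta_congr {n : ℕ} {P Q : ℕ → ℕ → Bool} (hs : Supported n P) (hr : Reduced n P)
    (hs' : Supported n Q) (hr' : Reduced n Q) {x y : ℕ}
    (h : ∀ t, CrossTime n Q t x y ↔ CrossTime n P t x y) : theta n Q x y = theta n P x y := by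
  by_cases h0 : theta n P x y = 0
  · rw [h0]
    apply theta_eq_zero_of_forall hs'
    intro t ht
    rw [h] at ht
    exact (theta_ne_zero_iff hr).2 ⟨_, _, (ht.exists_box hs).2⟩ h0
  · obtain ⟨t, ht⟩ := exists_crossTime_of_theta_ne_zero hs h0
    rw [theta_eq_of_crossTime hs hr ht, theta_eq_of_crossTime hs' hr' ((h t).2 ht)]

end PipeDream

namespace IsChuteRect

open PipeDream Equiv

variable {n : ℕ} {P : ℕ → ℕ → Bool} {a b c d : ℕ}

theorem theta_top (hs : Supported n P) (hr : Reduced n P) (R : IsChuteRect n P a b c d) {y : ℕ}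
    (h1 : c < y) (h2 : y ≤ d) : theta n P (westLabel n P b c) (northLabel n P a y) = a :=
  theta_eq_of_crossAt hr (R.crossAt_top hs h1 h2)

theorem theta_bot (hs : Supported n P) (hr : Reduced n P) (R : IsChuteRect n P a b c d) {y : ℕ}
    (h1 : c < y) (h2 : y < d) :
    theta n P (northLabel n P (b + 1) c) (northLabel n P a y) = b :=
  theta_eq_of_crossAt hr (R.crossAt_bot hs h1 h2)

theorem theta_mid (hs : Supported n P) (hr : Reduced n P) (R : IsChuteRect n P a b c d) {r y : ℕ}
    (h1 : a < r) (h2 : r < b) (h3 : c < y) (h4 : y ≤ d) :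
    theta n P (westLabel n P r c) (northLabel n P a y) = r :=
  theta_eq_of_crossAt hr (R.crossAt_mid hs h1 h2 h3 h4)

theorem one_le_mid (hs : Supported n P) (R : IsChuteRect n P a b c d) {r : ℕ}
    (h1 : a < r) (h2 : r < b) : 1 ≤ westLabel n P r c :=
  ((R.crossAt_left hs h1 h2).mem hs).1

theorem one_le_left (hs : Supported n P) (R : IsChuteRect n P a b c d) : 1 ≤ westLabel n P b c :=
  ((R.crossAt_top hs R.col_lt le_rfl).mem hs).1

theorem top_le (hs : Supported n P) (R : IsChuteRect n P a b c d) {y : ℕ} (h1 : c < y)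
    (h2 : y ≤ d) : northLabel n P a y ≤ n :=
  ((R.crossAt_top hs h1 h2).symm.mem hs).2

/-- No pipe smaller than the right pipe crosses it in the bottom row of the rectangle. -/
theorem theta_right_ne (hs : Supported n P) (hr : Reduced n P) (R : IsChuteRect n P a b c d)
    {x : ℕ} (hx : x < northLabel n P (b + 1) c) :
    theta n P x (northLabel n P (b + 1) c) ≠ b := by
  intro h
  have e1 := R.le_bound
  have e2 := R.one_le_col
  have e3 := R.col_lt
  have e4 := R.row_lt
  obtain ⟨y, hy⟩ := exists_crossAt_of_theta_ne_zero (P := P) (n := n)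
    (x := x) (y := northLabel n P (b + 1) c) (by omega)
  rw [h] at hy
  have h2 := hy.labels_eq hs hr hx
  have h3 := hy.2.1
  have h4 := hy.2.2.1
  have := north_injective hs (by omega) h3 e2 (by omega) (by omega) h2.2
  subst this
  exact absurd hy.2.2.2.1 (by simp [R.sw])

theorem theta_chuteResult_of_ne (hs : Supported n P) (hr : Reduced n P)
    (R : IsChuteRect n P a b c d) {x y : ℕ} (hx : x ≠ westLabel n P b c)
    (hx' : x ≠ northLabel n P (b + 1) c) (hy : y ≠ westLabel n P b c)
    (hy' : y ≠ northLabel n P (b + 1) c) :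
    theta n (chuteResult P a b c d) x y = theta n P x y := by
  apply theta_congr hs hr (R.supported_chuteResult hs) (R.reduced_chuteResult hs hr)
  intro t
  have h0 := R.time_lt
  rcases eq_or_ne t (boxTime n b c) with rfl | h1
  · rw [R.crossTime_chuteResult_sw hs]
    refine ⟨fun h => by omega, fun h => ?_⟩
    have := h.2
    have e1 := R.le_bound
    have e2 := R.one_le_col
    have e3 := R.col_lt
    exact absurd h.1 (by
      rw [boxTime_div e2 (by omega), boxTime_mod e2 (by omega), show n - (n - b) = b by omega,
        show c - 1 + 1 = c by omega, R.sw]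
      simp)
  rcases eq_or_ne t (boxTime n a d) with rfl | h2
  · refine ⟨fun h => absurd h R.not_crossTime_chuteResult_ne, fun h => ?_⟩
    have hij := R.crossTime_ne hs
    have h1 := h.2
    have h2 := hij.2
    omega
  by_cases hm : boxTime n b c < t ∧ t < boxTime n a d
  · rw [R.crossTime_chuteResult_mid hs hm.1 hm.2, swap_apply_of_ne_of_ne hx hx',
      swap_apply_of_ne_of_ne hy hy']
  · exact R.crossTime_chuteResult_out hs (by omega)

theorem theta_chuteResult_side (hs : Supported n P) (hr : Reduced n P)
    (R : IsChuteRect n P a b c d) {x z : ℕ}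
    (hx : x = westLabel n P b c ∨ x = northLabel n P (b + 1) c) (hz : z ≠ westLabel n P b c)
    (hz' : z ≠ northLabel n P (b + 1) c) (hB : ∀ y, c < y → y < d → z ≠ northLabel n P a y) :
    theta n (chuteResult P a b c d) x z = theta n P x z := by
  have e1 := R.le_bound
  have e2 := R.one_le_col
  have e3 := R.col_lt
  have hs' := R.supported_chuteResult hs
  have hr' := R.reduced_chuteResult hs hr
  have mid : ∀ {r y}, a < r → r < b → c ≤ y → y ≤ d →
      boxTime n b c < boxTime n r y ∧ boxTime n r y < boxTime n a d := fun h1 h2 h3 h4 =>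
    R.time_mem h1.le h2.le h3 h4 (by omega) (by omega)
  have h0 := R.time_lt
  by_cases hA : ∃ r, a < r ∧ r < b ∧ z = westLabel n P r c
  · obtain ⟨r, h1, h2, rfl⟩ := hA
    have m1 := mid h1 h2 le_rfl e3.le
    have m2 := mid h1 h2 e3.le le_rfl
    have c1 := ((R.crossAt_left hs h1 h2).crossTime hs).symm
    have c2 := ((R.crossAt_mid hs h1 h2 e3 le_rfl).crossTime hs).symm
    rw [R.north_right] at c2
    have row : ∀ y, 1 ≤ y → y ≤ n → n - boxTime n r y / n = r := fun y h h' => by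
      rw [boxTime_div h h']; omega
    rcases hx with rfl | rfl
    · rw [theta_eq_of_crossTime hs hr c1, row c e2 (by omega)]
      rw [theta_eq_of_crossTime hs' hr' (t := boxTime n r d), row d (by omega) (by omega)]
      rw [R.crossTime_chuteResult_mid hs m2.1 m2.2, swap_apply_left, swap_apply_of_ne_of_ne hz hz']
      exact c2
    · rw [theta_eq_of_crossTime hs hr c2, row d (by omega) (by omega)]
      rw [theta_eq_of_crossTime hs' hr' (t := boxTime n r c), row c e2 (by omega)]
      rw [R.crossTime_chuteResult_mid hs m1.1 m1.2, swap_apply_right,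
        swap_apply_of_ne_of_ne hz hz']
      exact c1
  · apply theta_congr hs hr hs' hr'
    intro t
    have nomid : ∀ x', (x' = westLabel n P b c ∨ x' = northLabel n P (b + 1) c) →
        boxTime n b c < t → t < boxTime n a d → ¬ CrossTime n P t x' z := by
      intro x' hx' h1 h2 h
      have : (∃ r, a < r ∧ r < b ∧ z = westLabel n P r c) ∨
          ∃ y, c < y ∧ y < d ∧ z = northLabel n P a y := by
        rcases hx' with rfl | rfl
        · exact R.crossTime_left hs h1 h2 h
        · exact R.crossTime_right hs h1 h2 h
      rcases this with h | ⟨y, hy1, hy2, hy3⟩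
      · exact hA h
      · exact hB y hy1 hy2 hy3
    rcases eq_or_ne t (boxTime n b c) with rfl | h1
    · rw [R.crossTime_chuteResult_sw hs]
      refine ⟨fun h => by omega, fun h => ?_⟩
      exact absurd h.1 (by
        rw [boxTime_div e2 (by omega), boxTime_mod e2 (by omega), show n - (n - b) = b by omega,
          show c - 1 + 1 = c by omega, R.sw]
        simp)
    rcases eq_or_ne t (boxTime n a d) with rfl | h2
    · refine ⟨fun h => absurd h R.not_crossTime_chuteResult_ne, fun h => ?_⟩
      have hij := R.crossTime_ne hs
      have h1 := h.2
      have h2 := hij.2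
      omega
    by_cases hm : boxTime n b c < t ∧ t < boxTime n a d
    · rw [R.crossTime_chuteResult_mid hs hm.1 hm.2, swap_apply_of_ne_of_ne hz hz']
      refine iff_of_false (nomid _ ?_ hm.1 hm.2) (nomid _ hx hm.1 hm.2)
      rcases hx with rfl | rfl <;> simp
    · exact R.crossTime_chuteResult_out hs (by omega)

theorem theta_chuteResult_exchange (hs : Supported n P) (hr : Reduced n P)
    (R : IsChuteRect n P a b c d) {y : ℕ} (h1 : c < y) (h2 : y < d) :
    theta n (chuteResult P a b c d) (westLabel n P b c) (northLabel n P a y) = b ∧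
      theta n (chuteResult P a b c d) (northLabel n P (b + 1) c) (northLabel n P a y) = a := by
  have e1 := R.le_bound
  have e2 := R.one_le_col
  have e4 := R.row_lt
  have e5 := R.one_le_row
  have hs' := R.supported_chuteResult hs
  have hr' := R.reduced_chuteResult hs hr
  have m1 := R.time_mem (r := a) (y := y) le_rfl e4.le h1.le h2.le (by omega) (by omega)
  have m2 := R.time_mem (r := b) (y := y) e4.le le_rfl h1.le h2.le (by omega) (by omega)
  have n1 := R.left_lt_top hs hr h1 h2.le
  have n2 := R.south_lt_top hs hr h1 h2
  constructor
  · rw [theta_eq_of_crossTime hs' hr' (t := boxTime n b y), boxTime_div (by omega) (by omega)]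
    · omega
    · rw [R.crossTime_chuteResult_mid hs m2.1 m2.2, swap_apply_left,
        swap_apply_of_ne_of_ne n1.ne' n2.ne']
      exact (R.crossAt_bot hs h1 h2).crossTime hs
  · rw [theta_eq_of_crossTime hs' hr' (t := boxTime n a y), boxTime_div (by omega) (by omega)]
    · omega
    · rw [R.crossTime_chuteResult_mid hs m1.1 m1.2, swap_apply_right,
        swap_apply_of_ne_of_ne n1.ne' n2.ne']
      exact (R.crossAt_top hs h1 h2.le).crossTime hs

theorem theta_chuteResult_sw (hs : Supported n P) (hr : Reduced n P)
    (R : IsChuteRect n P a b c d) :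
    theta n (chuteResult P a b c d) (westLabel n P b c) (northLabel n P (b + 1) c) = b := by
  have e1 := R.le_bound
  have e2 := R.one_le_col
  have e3 := R.col_lt
  rw [theta_eq_of_crossTime (R.supported_chuteResult hs) (R.reduced_chuteResult hs hr)
    (t := boxTime n b c), boxTime_div e2 (by omega)]
  · omega
  · rw [R.crossTime_chuteResult_sw hs]
    exact Or.inl ⟨rfl, rfl⟩

/-- The columns of the inversions tableau changed by a chute move. -/
theorem theta_chuteResult_top (hs : Supported n P) (hr : Reduced n P)
    (R : IsChuteRect n P a b c d) {x y : ℕ} (h1 : c < y) (h2 : y ≤ d)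
    (hxy : x < northLabel n P a y) :
    theta n (chuteResult P a b c d) x (northLabel n P a y) =
      swap a b (theta n P x (northLabel n P a y)) := by
  have hT := isBalancedColInj_theta hs hr
  have e1 := R.one_le_row
  have e2 := R.row_lt
  have e3 := R.theta_top hs hr h1 h2
  have e4 := R.left_lt_top hs hr h1 h2
  rcases eq_or_ne x (westLabel n P b c) with rfl | hx
  · rw [e3, swap_apply_left]
    rcases h2.lt_or_eq with h2 | rfl
    · exact (R.theta_chuteResult_exchange hs hr h1 h2).1
    · rw [R.north_right]
      exact R.theta_chuteResult_sw hs hr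
  have na := hT.inj _ _ _ e4 hxy hx.symm (by omega)
  rw [e3] at na
  rcases h2.lt_or_eq with h2 | rfl
  · have e5 := R.theta_bot hs hr h1 h2
    have e6 := R.south_lt_top hs hr h1 h2
    rcases eq_or_ne x (northLabel n P (b + 1) c) with rfl | hx'
    · rw [e5, swap_apply_right]
      exact (R.theta_chuteResult_exchange hs hr h1 h2).2
    have nb := hT.inj _ _ _ e6 hxy hx'.symm (by omega)
    rw [e5] at nb
    rw [swap_apply_of_ne_of_ne na.symm nb.symm]
    exact R.theta_chuteResult_of_ne hs hr hx hx' e4.ne' e6.ne'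
  · rw [R.north_right] at na hxy ⊢
    rw [swap_apply_of_ne_of_ne na.symm (R.theta_right_ne hs hr hxy),
      theta_comm (R.reduced_chuteResult hs hr), theta_comm hr]
    apply R.theta_chuteResult_side hs hr (Or.inr rfl) hx hxy.ne
    rintro y hy hy' rfl
    have := R.south_lt_top hs hr hy hy'
    omega

theorem theta_chuteResult_other (hs : Supported n P) (hr : Reduced n P)
    (R : IsChuteRect n P a b c d) {x y : ℕ} (hxy : x < y)
    (hy : ∀ z, c < z → z ≤ d → northLabel n P a z ≠ y) :
    theta n (chuteResult P a b c d) x y = theta n P x y := by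
  have hj := hy d R.col_lt le_rfl
  have hij := R.left_lt_south hs hr
  rw [R.north_right] at hj
  have hB : ∀ z, c < z → z < d → y ≠ northLabel n P a z := fun z h h' => (hy z h h'.le).symm
  by_cases hi : y = westLabel n P b c
  · rw [theta_comm (R.reduced_chuteResult hs hr), theta_comm hr]
    apply R.theta_chuteResult_side hs hr (Or.inl hi) (by omega) (by omega)
    rintro z hz hz' rfl
    have := R.left_lt_top hs hr hz hz'.le
    omega
  · by_cases hx : x = westLabel n P b c ∨ x = northLabel n P (b + 1) c
    · exact R.theta_chuteResult_side hs hr hx hi hj.symm hB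
    · push Not at hx
      exact R.theta_chuteResult_of_ne hs hr hx.1 hx.2 hi hj.symm

theorem theta_chuteResult_eq_zero_iff (hs : Supported n P) (hr : Reduced n P)
    (R : IsChuteRect n P a b c d) {x y : ℕ} (hxy : x < y) :
    theta n (chuteResult P a b c d) x y = 0 ↔ theta n P x y = 0 := by
  have e1 := R.one_le_row
  have e2 := R.row_lt
  by_cases h : ∃ z, c < z ∧ z ≤ d ∧ northLabel n P a z = y
  · obtain ⟨z, h1, h2, rfl⟩ := h
    rw [R.theta_chuteResult_top hs hr h1 h2 hxy, swap_apply_eq_iff,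
      swap_apply_of_ne_of_ne (by omega) (by omega)]
  · push Not at h
    rw [R.theta_chuteResult_other hs hr hxy h]

end IsChuteRect

/-- The boxes in which the Lehmer tableau is increased by a chute move. -/
def chuteBoxes (n : ℕ) (P : ℕ → ℕ → Bool) (a b c d : ℕ) : Finset (ℕ × ℕ) :=
  (Finset.Ioc c d).image fun y => (westLabel n P b c, northLabel n P a y)

theorem mem_chuteBoxes {n : ℕ} {P : ℕ → ℕ → Bool} {a b c d x y : ℕ} :
    (x, y) ∈ chuteBoxes n P a b c d ↔
      x = westLabel n P b c ∧ ∃ z, c < z ∧ z ≤ d ∧ northLabel n P a z = y := by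
  simp only [chuteBoxes, Finset.mem_image, Finset.mem_Ioc, Prod.mk.injEq]
  constructor
  · rintro ⟨z, h, h1, h2⟩
    exact ⟨h1.symm, z, h.1, h.2, h2⟩
  · rintro ⟨h1, z, h, h', h2⟩
    exact ⟨z, ⟨h, h'⟩, h1.symm, h2⟩

namespace IsChuteRect

open PipeDream Equiv

variable {n : ℕ} {P : ℕ → ℕ → Bool} {a b c d : ℕ}

theorem card_chuteBoxes (hs : Supported n P) (R : IsChuteRect n P a b c d) :
    (chuteBoxes n P a b c d).card = d - c := by
  rw [chuteBoxes, Finset.card_image_of_injOn, Nat.card_Ioc]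
  intro y hy z hz e
  have e1 := R.le_bound
  have e2 := R.one_le_col
  have e4 := R.row_lt
  have e5 := R.one_le_row
  simp only [Finset.coe_Ioc, Set.mem_Ioc, Prod.mk.injEq] at hy hz e
  exact north_injective hs e5 (by omega) (by omega) (by omega) (by omega) e.2

theorem lt_of_mem (hs : Supported n P) (hr : Reduced n P) (R : IsChuteRect n P a b c d) {x y : ℕ}
    (h : (x, y) ∈ chuteBoxes n P a b c d) : x < y := by
  rw [mem_chuteBoxes] at h
  obtain ⟨rfl, z, h1, h2, rfl⟩ := h
  exact R.left_lt_top hs hr h1 h2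

theorem le_of_mem (hs : Supported n P) (R : IsChuteRect n P a b c d) {x y : ℕ}
    (h : (x, y) ∈ chuteBoxes n P a b c d) : y ≤ n := by
  rw [mem_chuteBoxes] at h
  obtain ⟨rfl, z, h1, h2, rfl⟩ := h
  exact R.top_le hs h1 h2

theorem theta_of_mem (hs : Supported n P) (hr : Reduced n P) (R : IsChuteRect n P a b c d)
    {x y : ℕ} (h : (x, y) ∈ chuteBoxes n P a b c d) : theta n P x y = a := by
  rw [mem_chuteBoxes] at h
  obtain ⟨rfl, z, h1, h2, rfl⟩ := h
  exact R.theta_top hs hr h1 h2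

/-- A chute move adds `1` to the Lehmer tableau in the boxes of `chuteBoxes`. -/
theorem phi_chuteResult (hs : Supported n P) (hr : Reduced n P) (R : IsChuteRect n P a b c d)
    {x y : ℕ} (hxy : x < y) : phi n (chuteResult P a b c d) x y =
      phi n P x y + if (x, y) ∈ chuteBoxes n P a b c d then 1 else 0 := by
  have hT := isBalancedColInj_theta hs hr
  by_cases h : ∃ z, c < z ∧ z ≤ d ∧ northLabel n P a z = y
  · obtain ⟨z, h1, h2, rfl⟩ := h
    have key := card_free_swap (f := fun x => theta n P x (northLabel n P a z))
      (f' := fun x => theta n (chuteResult P a b c d) x (northLabel n P a z))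
      (N := northLabel n P a z) (i := westLabel n P b c) R.one_le_row R.row_lt (R.one_le_left hs)
      (fun x x' hx hx' hne h0 => hT.inj _ _ _ hx hx' hne h0) (R.theta_top hs hr h1 h2)
      (R.left_lt_top hs hr h1 h2) ?_ ?_ (fun x hx => R.theta_chuteResult_top hs hr h1 h2 hx) hxy
    · have e : (x, northLabel n P a z) ∈ chuteBoxes n P a b c d ↔ x = westLabel n P b c := by
        rw [mem_chuteBoxes]
        exact ⟨fun h => h.1, fun h => ⟨h, z, h1, h2, rfl⟩⟩
      simp only [e]
      exact key
    · intro x hx hb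
      rcases h2.lt_or_eq with h2 | rfl
      · have e5 := R.theta_bot hs hr h1 h2
        have e6 := R.south_lt_top hs hr h1 h2
        have e7 := R.left_lt_south hs hr
        have e8 := R.row_lt
        exact hT.inj _ _ _ e6 (show x < northLabel n P a z by omega) (by omega) (by omega)
          (e5.trans hb.symm)
      · have := R.left_lt_south hs hr
        rw [R.north_right] at hb
        exact R.theta_right_ne hs hr (by omega) hb
    · intro k hk hk'
      exact ⟨westLabel n P k c, R.one_le_mid hs hk hk', R.mid_lt_left hs hr hk hk',
        R.theta_mid hs hr hk hk' h1 h2⟩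
  · have hn : (x, y) ∉ chuteBoxes n P a b c d := by
      rw [mem_chuteBoxes]
      exact fun h' => h h'.2
    push Not at h
    rw [if_neg hn, add_zero, phi, phi, lehmer, lehmer, R.theta_chuteResult_other hs hr hxy h]
    congr 1
    ext k
    simp only [Finset.mem_filter]
    refine and_congr_right fun _ => forall_congr' fun m => forall_congr' fun _ =>
      forall_congr' fun hm => ?_
    rw [R.theta_chuteResult_other hs hr (by omega) h]

end IsChuteRect

/-! ### Pairs of chute rectangles -/

namespace IsChuteRect

open PipeDream Equiv

variable {n : ℕ} {P : ℕ → ℕ → Bool} {a b c d a' b' c' d' : ℕ}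

theorem corner_of_bump (R : IsChuteRect n P a b c d) {r y : ℕ} (h1 : a ≤ r) (h2 : r ≤ b)
    (h3 : c ≤ y) (h4 : y ≤ d) (hP : P r y = false) :
    (r = a ∧ y = c) ∨ (r = b ∧ y = c) ∨ (r = b ∧ y = d) := by
  by_contra hc
  push Not at hc
  have := R.cross h1 h2 h3 h4 (by omega) (by omega) (by omega)
  simp [hP] at this

theorem eq_of_sw_eq (R : IsChuteRect n P a b c d) (R' : IsChuteRect n P a' b c d') :
    a = a' ∧ d = d' := by
  have e1 := R.row_lt
  have e2 := R.col_lt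
  have e3 := R'.row_lt
  have e4 := R'.col_lt
  constructor
  · rcases lt_trichotomy a a' with h | h | h
    · have := R.corner_of_bump h.le e3.le le_rfl e2.le R'.nw
      omega
    · exact h
    · have := R'.corner_of_bump h.le e1.le le_rfl e4.le R.nw
      omega
  · rcases lt_trichotomy d d' with h | h | h
    · have := R'.corner_of_bump e3.le le_rfl e2.le h.le R.se
      omega
    · exact h
    · have := R.corner_of_bump e1.le le_rfl e4.le h.le R'.se
      omega

theorem disjoint_chuteBoxes (hs : Supported n P) (hr : Reduced n P) (R : IsChuteRect n P a b c d)
    (R' : IsChuteRect n P a' b' c' d') (hne : (b, c) ≠ (b', c')) :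
    Disjoint (chuteBoxes n P a b c d) (chuteBoxes n P a' b' c' d') := by
  rw [Finset.disjoint_left]
  rintro ⟨x, y⟩ h h'
  have ha : a = a' := (R.theta_of_mem hs hr h).symm.trans (R'.theta_of_mem hs hr h')
  subst ha
  have f1 := R.row_lt
  have f2 := R.col_lt
  have f3 := R.le_bound
  have f4 := R.one_le_col
  have g1 := R'.row_lt
  have g2 := R'.col_lt
  have g3 := R'.le_bound
  have g4 := R'.one_le_col
  have hN := R.north_col (r := a + 1) (by omega) (by omega)
  have hN' := R'.north_col (r := a + 1) (by omega) (by omega)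
  rw [mem_chuteBoxes] at h h'
  have := north_injective hs (by omega) f4 g4 (by omega) (by omega)
    ((hN.trans h.1.symm).trans (h'.1.trans hN'.symm))
  subst this
  rcases lt_trichotomy b b' with hb | rfl | hb
  · have := R'.corner_of_bump f1.le hb.le le_rfl g2.le R.sw
    omega
  · exact hne rfl
  · have := R.corner_of_bump g1.le hb.le le_rfl f2.le R'.sw
    omega

/-- Two chute rectangles such that neither southwest corner is a corner of the other rectangle. -/
def Independent (a b c d a' b' c' d' : ℕ) : Prop :=
  ((b, c) ≠ (a', c') ∧ (b, c) ≠ (a', d') ∧ (b, c) ≠ (b', c') ∧ (b, c) ≠ (b', d')) ∧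
    ((b', c') ≠ (a, c) ∧ (b', c') ≠ (a, d) ∧ (b', c') ≠ (b, c) ∧ (b', c') ≠ (b, d))

theorem chuteResult_of_independent (R : IsChuteRect n P a b c d)
    (R' : IsChuteRect n P a' b' c' d') (h : Independent a b c d a' b' c' d') :
    IsChuteRect n (chuteResult P a' b' c' d') a b c d := by
  obtain ⟨h1, h2⟩ := h
  simp only [ne_eq, Prod.mk.injEq] at h1 h2
  have f1 := R.row_lt
  have f2 := R.col_lt
  have g1 := R'.row_lt
  have g2 := R'.col_lt
  have hsw : ¬ (a ≤ b' ∧ b' ≤ b ∧ c ≤ c' ∧ c' ≤ d) := by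
    rintro ⟨k1, k2, k3, k4⟩
    have := R.corner_of_bump k1 k2 k3 k4 R'.sw
    omega
  have hne : ¬ (a ≤ a' ∧ a' ≤ b ∧ c ≤ d' ∧ d' ≤ d) := by
    rintro ⟨k1, k2, k3, k4⟩
    rcases le_or_gt b' b with hb | hb
    · have := R.corner_of_bump (by omega) hb k3 k4 R'.se
      have hc : c' < c := by omega
      have hb' : b = b' := by omega
      have := R'.corner_of_bump (r := b) (y := c) (by omega) (by omega) hc.le (by omega) R.sw
      omega
    · rcases le_or_gt c c' with hc | hc
      · have := R.corner_of_bump k1 k2 hc (by omega) R'.nw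
        have := R'.corner_of_bump (r := b) (y := c) (by omega) (by omega) (by omega) (by omega) R.sw
        omega
      · have := R'.corner_of_bump (r := b) (y := c) (by omega) (by omega) (by omega) (by omega) R.sw
        omega
  have key : ∀ r y, a ≤ r → r ≤ b → c ≤ y → y ≤ d →
      chuteResult P a' b' c' d' r y = P r y := by
    intro r y k1 k2 k3 k4
    rw [chuteResult, if_neg (by rintro ⟨rfl, rfl⟩; omega), if_neg (by rintro ⟨rfl, rfl⟩; omega)]
  refine ⟨R.one_le_row, f1, R.one_le_col, f2, R.le_bound, ?_, ?_, ?_, ?_⟩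
  · rw [key _ _ (by omega) (by omega) (by omega) (by omega), R.nw]
  · rw [key _ _ (by omega) (by omega) (by omega) (by omega), R.sw]
  · rw [key _ _ (by omega) (by omega) (by omega) (by omega), R.se]
  · intro r y k1 k2 k3 k4 k5 k6 k7
    rw [key _ _ k1 k2 k3 k4, R.cross k1 k2 k3 k4 k5 k6 k7]

theorem chuteResult_comm (h : Independent a b c d a' b' c' d') :
    chuteResult (chuteResult P a' b' c' d') a b c d =
      chuteResult (chuteResult P a b c d) a' b' c' d' := by
  obtain ⟨h1, h2⟩ := h
  simp only [ne_eq, Prod.mk.injEq] at h1 h2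
  funext r y
  simp only [chuteResult]
  split_ifs <;> first | rfl | omega

theorem Independent.symm (h : Independent a b c d a' b' c' d') :
    Independent a' b' c' d' a b c d := ⟨h.2, h.1⟩

/-- Two distinct chute rectangles are independent, stacked, or side by side. -/
theorem independent_or (R : IsChuteRect n P a b c d) (R' : IsChuteRect n P a' b' c' d')
    (hne : (b, c) ≠ (b', c')) :
    Independent a b c d a' b' c' d' ∨ (b = a' ∧ c = c') ∨ (b' = a ∧ c' = c) ∨
      (b = b' ∧ c = d') ∨ (b' = b ∧ c' = d) := by
  have f1 := R.row_lt
  have f2 := R.col_lt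
  have g1 := R'.row_lt
  have g2 := R'.col_lt
  have k1 : ¬ (b = a' ∧ c = d') := by
    rintro ⟨rfl, rfl⟩
    have := R'.corner_of_bump le_rfl g1.le g2.le le_rfl R.sw
    omega
  have k2 : ¬ (b' = a ∧ c' = d) := by
    rintro ⟨rfl, rfl⟩
    have := R.corner_of_bump le_rfl f1.le f2.le le_rfl R'.sw
    omega
  simp only [Independent, ne_eq, Prod.mk.injEq] at hne ⊢
  omega

/-- The chute moves of two stacked rectangles `(a, b, c, d)` and `(b, b', c, d')`. -/
theorem stacked (R : IsChuteRect n P a b c d) (R' : IsChuteRect n P b b' c d') :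
    IsChuteRect n (chuteResult P a b c d) a b' c d' ∧
      IsChuteRect n (chuteResult P b b' c d') a b c d' ∧
      IsChuteRect n (chuteResult (chuteResult P b b' c d') a b c d') a b d' d ∧
      chuteResult (chuteResult P a b c d) a b' c d' =
        chuteResult (chuteResult (chuteResult P b b' c d') a b c d') a b d' d := by
  have f1 := R.row_lt
  have f2 := R.col_lt
  have f3 := R.one_le_row
  have f4 := R.one_le_col
  have f5 := R.le_bound
  have g1 := R'.row_lt
  have g2 := R'.col_lt
  have g5 := R'.le_bound
  have hd : d' < d := by
    by_contra hd
    have := R'.corner_of_bump le_rfl g1.le f2.le (by omega) R.se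
    omega
  have cr : ∀ r y, a ≤ r → r ≤ b → c ≤ y → y ≤ d → ¬(r = a ∧ y = c) → ¬(r = b ∧ y = c) →
      ¬(r = b ∧ y = d) → P r y = true := fun r y h1 h2 h3 h4 => R.cross h1 h2 h3 h4
  have cr' : ∀ r y, b ≤ r → r ≤ b' → c ≤ y → y ≤ d' → ¬(r = b ∧ y = c) → ¬(r = b' ∧ y = c) →
      ¬(r = b' ∧ y = d') → P r y = true := fun r y h1 h2 h3 h4 => R'.cross h1 h2 h3 h4
  refine ⟨⟨f3, by omega, f4, g2, by omega, ?_, ?_, ?_, ?_⟩,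
    ⟨f3, f1, f4, g2, by omega, ?_, ?_, ?_, ?_⟩, ⟨f3, f1, by omega, hd, f5, ?_, ?_, ?_, ?_⟩, ?_⟩
  · simp [chuteResult, f1.ne, R.nw]
  · simp [chuteResult, g1.ne', R'.sw]
  · simp [chuteResult, g1.ne', R'.se]
  · intro r y h1 h2 h3 h4 h5 h6 h7
    rw [chuteResult]
    split_ifs with k1 k2
    · rfl
    · omega
    · rcases le_or_gt r b with h | h
      · exact cr r y h1 h h3 (by omega) (by omega) (by omega) (by omega)
      · exact cr' r y h.le h2 h3 h4 (by omega) (by omega) (by omega)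
  · simp [chuteResult, (f1.trans g1).ne, f1.ne, R.nw]
  · simp [chuteResult, g1.ne, g2.ne, R.sw]
  · simp [chuteResult, g1.ne]
  · intro r y h1 h2 h3 h4 h5 h6 h7
    rw [chuteResult]
    split_ifs
    · omega
    · exact cr r y h1 h2 h3 (by omega) (by omega) (by omega) (by omega)
  · simp [chuteResult, f1.ne]
  · simp [chuteResult, f1.ne', g1.ne, g2.ne']
  · simp [chuteResult, f1.ne', g1.ne, f2.ne', hd.ne', R.se]
  · intro r y h1 h2 h3 h4 h5 h6 h7
    rw [chuteResult, chuteResult]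
    split_ifs <;> first | rfl | omega | skip
    · exact cr r y h1 h2 (by omega) (by omega) (by omega) (by omega) (by omega)
  · have h1 := cr b d' (by omega) le_rfl g2.le hd.le (by omega) (by omega) (by omega)
    funext r y
    simp only [chuteResult]
    split_ifs <;> first | rfl | omega | simp_all

/-- The chute moves of two rectangles `(a, b, m, d)` and `(a', b, c, m)` side by side. -/
theorem side {m : ℕ} (R : IsChuteRect n P a b m d) (R' : IsChuteRect n P a' b c m) :
    a < a' ∧ IsChuteRect n (chuteResult P a b m d) a' b c d ∧
      IsChuteRect n (chuteResult P a' b c m) a' b m d ∧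
      IsChuteRect n (chuteResult (chuteResult P a' b c m) a' b m d) a a' m d ∧
      chuteResult (chuteResult P a b m d) a' b c d =
        chuteResult (chuteResult (chuteResult P a' b c m) a' b m d) a a' m d := by
  have f1 := R.row_lt
  have f2 := R.col_lt
  have f3 := R.one_le_row
  have f4 := R.one_le_col
  have f5 := R.le_bound
  have g1 := R'.row_lt
  have g2 := R'.col_lt
  have g4 := R'.one_le_col
  have ha : a < a' := by
    by_contra ha
    have := R'.corner_of_bump (not_lt.1 ha) f1.le g2.le le_rfl R.nw
    omega
  have cr : ∀ r y, a ≤ r → r ≤ b → m ≤ y → y ≤ d → ¬(r = a ∧ y = m) → ¬(r = b ∧ y = m) →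
      ¬(r = b ∧ y = d) → P r y = true := fun r y h1 h2 h3 h4 => R.cross h1 h2 h3 h4
  have cr' : ∀ r y, a' ≤ r → r ≤ b → c ≤ y → y ≤ m → ¬(r = a' ∧ y = c) → ¬(r = b ∧ y = c) →
      ¬(r = b ∧ y = m) → P r y = true := fun r y h1 h2 h3 h4 => R'.cross h1 h2 h3 h4
  refine ⟨ha, ⟨by omega, g1, g4, by omega, f5, ?_, ?_, ?_, ?_⟩,
    ⟨by omega, g1, f4, f2, f5, ?_, ?_, ?_, ?_⟩, ⟨f3, ha, f4, f2, by omega, ?_, ?_, ?_, ?_⟩, ?_⟩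
  · simp [chuteResult, g1.ne, ha.ne', R'.nw]
  · simp [chuteResult, g2.ne, f1.ne', R'.sw]
  · simp [chuteResult, f2.ne', f1.ne', R.se]
  · intro r y h1 h2 h3 h4 h5 h6 h7
    rw [chuteResult]
    split_ifs with k1 k2
    · rfl
    · omega
    · rcases le_or_gt y m with h | h
      · exact cr' r y h1 h2 h3 h (by omega) (by omega) (by omega)
      · exact cr r y (by omega) h2 h.le h4 (by omega) (by omega) (by omega)
  · simp [chuteResult, g1.ne]
  · simp [chuteResult, g1.ne', g2.ne', R.sw]
  · simp [chuteResult, g1.ne', (g2.trans f2).ne', R.se]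
  · intro r y h1 h2 h3 h4 h5 h6 h7
    rw [chuteResult]
    split_ifs
    · omega
    · exact cr r y (by omega) h2 h3 h4 (by omega) (by omega) (by omega)
  · simp [chuteResult, f1.ne, ha.ne, R.nw]
  · simp [chuteResult, g1.ne, f2.ne]
  · simp [chuteResult, g1.ne]
  · intro r y h1 h2 h3 h4 h5 h6 h7
    rw [chuteResult, chuteResult]
    split_ifs <;> first | rfl | omega | skip
    · exact cr r y h1 (by omega) (by omega) (by omega) (by omega) (by omega) (by omega)
  · have h1 := cr' a' m le_rfl g1.le g2.le le_rfl (by omega) (by omega) (by omega)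
    funext r y
    simp only [chuteResult]
    split_ifs <;> first | rfl | omega | simp_all

end IsChuteRect

/-! ### Lehmer tableaux along the chute move order -/

/-- Every entry of the Lehmer tableau of `P` is at most that of `Q`. -/
def PhiLE (n : ℕ) (P Q : ℕ → ℕ → Bool) : Prop :=
  ∀ x y, x < y → phi n P x y ≤ phi n Q x y

/-- The sum of the entries of the Lehmer tableau of `P`. -/
def phiSum (n : ℕ) (P : ℕ → ℕ → Bool) : ℕ :=
  ∑ p ∈ (Finset.range (n + 1) ×ˢ Finset.range (n + 1)).filter fun p => p.1 < p.2,
    phi n P p.1 p.2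

theorem PhiLE.trans {n : ℕ} {P Q S : ℕ → ℕ → Bool} (h : PhiLE n P Q) (h' : PhiLE n Q S) :
    PhiLE n P S :=
  fun x y hxy => (h x y hxy).trans (h' x y hxy)

theorem PhiLE.phiSum_le {n : ℕ} {P Q : ℕ → ℕ → Bool} (h : PhiLE n P Q) :
    phiSum n P ≤ phiSum n Q :=
  Finset.sum_le_sum fun p hp => h p.1 p.2 (Finset.mem_filter.1 hp).2

namespace RPD

open PipeDream

variable {n : ℕ} {w : Equiv.Perm (Fin n)} {X Y Z W : RPD w} {a b c d a' b' c' d' : ℕ}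

theorem supported (X : RPD w) : Supported n X.1 := X.2.1.1

theorem reduced (X : RPD w) : Reduced n X.1 := X.2.2

/-- The reduced pipe dream obtained by the chute move in a given rectangle. -/
def move (X : RPD w) (R : IsChuteRect n X.1 a b c d) : RPD w :=
  ⟨chuteResult X.1 a b c d, ⟨R.supported_chuteResult X.supported, fun y h1 hy =>
    (R.northLabel_one_chuteResult X.supported h1 hy).trans (X.2.1.2 y h1 hy)⟩,
    R.reduced_chuteResult X.supported X.reduced⟩

theorem step_move (X : RPD w) (R : IsChuteRect n X.1 a b c d) : ChuteStep n X.1 (X.move R).1 :=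
  ⟨a, b, c, d, R, rfl⟩

theorem le_move (X : RPD w) (R : IsChuteRect n X.1 a b c d) : chuteLE w X (X.move R) :=
  Relation.ReflTransGen.single (X.step_move R)

theorem phi_of_eq (R : IsChuteRect n X.1 a b c d) (hY : Y.1 = chuteResult X.1 a b c d) {x y : ℕ}
    (hxy : x < y) :
    phi n Y.1 x y = phi n X.1 x y + if (x, y) ∈ chuteBoxes n X.1 a b c d then 1 else 0 := by
  rw [hY]
  exact R.phi_chuteResult X.supported X.reduced hxy

theorem phiLE_of_step (h : ChuteStep n X.1 Y.1) : PhiLE n X.1 Y.1 := by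
  obtain ⟨a, b, c, d, R, hY⟩ := h
  intro x y hxy
  rw [phi_of_eq R hY hxy]
  omega

theorem phiLE_of_le (h : chuteLE w X Y) : PhiLE n X.1 Y.1 := by
  induction h with
  | refl => exact fun x y _ => le_rfl
  | tail _ h ih => exact ih.trans (phiLE_of_step h)

theorem theta_eq_zero_iff_of_le (h : chuteLE w X Y) {x y : ℕ} (hxy : x < y) :
    theta n X.1 x y = 0 ↔ theta n Y.1 x y = 0 := by
  induction h with
  | refl => rfl
  | @tail Y Z _ h ih =>
    obtain ⟨a, b, c, d, R, hZ⟩ := h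
    rw [ih, hZ, R.theta_chuteResult_eq_zero_iff Y.supported Y.reduced hxy]

/-- The easternmost box incremented by a chute move. -/
theorem mem_right (R : IsChuteRect n X.1 a b c d) :
    (westLabel n X.1 b c, northLabel n X.1 a d) ∈ chuteBoxes n X.1 a b c d :=
  mem_chuteBoxes.2 ⟨rfl, d, R.col_lt, le_rfl, rfl⟩

theorem phiSum_lt_of_step (h : ChuteStep n X.1 Y.1) : phiSum n X.1 < phiSum n Y.1 := by
  have hle := phiLE_of_step h
  obtain ⟨a, b, c, d, R, hY⟩ := h
  have hm := mem_right R
  have hlt := R.lt_of_mem X.supported X.reduced hm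
  have hn := R.le_of_mem X.supported hm
  refine Finset.sum_lt_sum (fun p hp => hle p.1 p.2 (Finset.mem_filter.1 hp).2)
    ⟨(westLabel n X.1 b c, northLabel n X.1 a d), ?_, ?_⟩
  · simp only [Finset.mem_filter, Finset.mem_product, Finset.mem_range]
    omega
  · rw [phi_of_eq R hY hlt, if_pos hm]
    exact Nat.lt_succ_self _

theorem not_phiLE_of_step (h : ChuteStep n X.1 Y.1) : ¬ PhiLE n Y.1 X.1 :=
  fun hle => absurd hle.phiSum_le (phiSum_lt_of_step h).not_ge

theorem eq_of_sw_eq (R : IsChuteRect n X.1 a b c d) (hY : Y.1 = chuteResult X.1 a b c d)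
    (R' : IsChuteRect n X.1 a' b' c' d') (hZ : Z.1 = chuteResult X.1 a' b' c' d')
    (h : (b, c) = (b', c')) : Y = Z := by
  obtain ⟨rfl, rfl⟩ := Prod.mk.inj h
  obtain ⟨rfl, rfl⟩ := R.eq_of_sw_eq R'
  exact Subtype.ext (hY.trans hZ.symm)

/-- If the move `X → Z` increments the same number of boxes as `Y → W`, then the latter
increments the same boxes. -/
theorem phi_square (R : IsChuteRect n X.1 a b c d) (hY : Y.1 = chuteResult X.1 a b c d)
    (R' : IsChuteRect n X.1 a' b' c' d') (hZ : Z.1 = chuteResult X.1 a' b' c' d')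
    (hne : (b, c) ≠ (b', c')) {e f g h : ℕ} (S : IsChuteRect n Y.1 e f g h)
    (hW : W.1 = chuteResult Y.1 e f g h) (hcard : h - g = d' - c') (hle : PhiLE n Z.1 W.1)
    {x y : ℕ} (hxy : x < y) :
    phi n W.1 x y = phi n X.1 x y + (if (x, y) ∈ chuteBoxes n X.1 a b c d then 1 else 0) +
      if (x, y) ∈ chuteBoxes n X.1 a' b' c' d' then 1 else 0 := by
  have hd := R.disjoint_chuteBoxes X.supported X.reduced R' hne
  have hsub : chuteBoxes n X.1 a' b' c' d' ⊆ chuteBoxes n Y.1 e f g h := by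
    rintro ⟨u, v⟩ huv
    have huv' := R'.lt_of_mem X.supported X.reduced huv
    have := hle u v huv'
    rw [phi_of_eq S hW huv', phi_of_eq R hY huv', phi_of_eq R' hZ huv', if_pos huv,
      if_neg (Finset.disjoint_right.1 hd huv)] at this
    by_contra hn
    rw [if_neg hn] at this
    omega
  have := Finset.eq_of_subset_of_card_le hsub (by
    rw [S.card_chuteBoxes Y.supported, R'.card_chuteBoxes X.supported, hcard])
  rw [phi_of_eq S hW hxy, phi_of_eq R hY hxy, this]

/-- A common upper bound `W` of `Y` and `Z` whose Lehmer tableau is below that of every pipe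
dream above `X` whose Lehmer tableau is above those of `Y` and `Z`. -/
def LocalJoin (X Y Z W : RPD w) : Prop :=
  chuteLE w Y W ∧ chuteLE w Z W ∧
    ∀ r, chuteLE w X r → PhiLE n Y.1 r.1 → PhiLE n Z.1 r.1 → PhiLE n W.1 r.1

theorem LocalJoin.symm (h : LocalJoin X Y Z W) : LocalJoin X Z Y W :=
  ⟨h.2.1, h.1, fun r h0 h1 h2 => h.2.2 r h0 h2 h1⟩

theorem localJoin_of_square (R : IsChuteRect n X.1 a b c d) (hY : Y.1 = chuteResult X.1 a b c d)
    (R' : IsChuteRect n X.1 a' b' c' d') (hZ : Z.1 = chuteResult X.1 a' b' c' d')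
    (hne : (b, c) ≠ (b', c')) {e f g h : ℕ} (S : IsChuteRect n Y.1 e f g h)
    (hW : W.1 = chuteResult Y.1 e f g h) (hcard : h - g = d' - c') (hle : chuteLE w Z W) :
    LocalJoin X Y Z W := by
  refine ⟨Relation.ReflTransGen.single ⟨_, _, _, _, S, hW⟩, hle, fun r _ h1 h2 x y hxy => ?_⟩
  have hd := R.disjoint_chuteBoxes X.supported X.reduced R' hne
  rw [phi_square R hY R' hZ hne S hW hcard (phiLE_of_le hle) hxy]
  have e1 := h1 x y hxy
  have e2 := h2 x y hxy
  rw [phi_of_eq R hY hxy] at e1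
  rw [phi_of_eq R' hZ hxy] at e2
  by_cases hb : (x, y) ∈ chuteBoxes n X.1 a b c d
  · rw [if_neg (Finset.disjoint_left.1 hd hb)]
    exact e1
  · rw [if_neg hb]
    exact e2

theorem localJoin_of_independent (R : IsChuteRect n X.1 a b c d)
    (hY : Y.1 = chuteResult X.1 a b c d) (R' : IsChuteRect n X.1 a' b' c' d')
    (hZ : Z.1 = chuteResult X.1 a' b' c' d')
    (hi : IsChuteRect.Independent a b c d a' b' c' d') (hW : W.1 = chuteResult Z.1 a b c d) :
    LocalJoin X Y Z W := by
  have S : IsChuteRect n Z.1 a b c d := by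
    rw [hZ]
    exact R.chuteResult_of_independent R' hi
  have S' : IsChuteRect n Y.1 a' b' c' d' := by
    rw [hY]
    exact R'.chuteResult_of_independent R hi.symm
  refine localJoin_of_square R hY R' hZ hi.1.2.2.1 S' ?_ rfl
    (Relation.ReflTransGen.single ⟨_, _, _, _, S, hW⟩)
  rw [hW, hZ, hY, IsChuteRect.chuteResult_comm hi]

theorem exists_localJoin_of_stacked (R : IsChuteRect n X.1 a b c d)
    (hY : Y.1 = chuteResult X.1 a b c d) (R' : IsChuteRect n X.1 b b' c d')
    (hZ : Z.1 = chuteResult X.1 b b' c d') : ∃ W, LocalJoin X Y Z W := by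
  obtain ⟨S, S1, S2, he⟩ := R.stacked R'
  rw [← hY] at S he
  rw [← hZ] at S1 S2 he
  have hle : chuteLE w Z (Y.move S) := by
    refine (Z.le_move S1).tail ⟨_, _, _, _, S2, he⟩
  exact ⟨Y.move S, localJoin_of_square R hY R' hZ (by simp [R'.row_lt.ne]) S rfl rfl hle⟩

end RPD

namespace RPD

open PipeDream

variable {n : ℕ} {w : Equiv.Perm (Fin n)} {X Y Z W : RPD w} {a b c d a' m : ℕ}

/-- For chute rectangles `(a, b, m, d)` and `(a', b, c, m)` side by side, the north labels of the
row `a'` in the columns `(c, d]` are not affected, as a set, by the first chute move. -/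
theorem exists_north_of_side (R : IsChuteRect n X.1 a b m d)
    (hY : Y.1 = chuteResult X.1 a b m d) (R' : IsChuteRect n X.1 a' b c m) {y : ℕ} (h1 : c < y)
    (h2 : y ≤ d) : ∃ z, c < z ∧ z ≤ d ∧ northLabel n X.1 a' z = northLabel n Y.1 a' y := by
  have ha := (R.side R').1
  have f1 := R.col_lt
  have f2 := R.le_bound
  have f3 := R.one_le_row
  have f4 := R.one_le_col
  have f5 := R.row_lt
  have g1 := R'.row_lt
  have g2 := R'.col_lt
  have e1 := state_row_end Y.supported (r := a') (c := y) (by omega) (by omega) (by omega)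
  have e2 := state_row_end X.supported (r := a') (c := y) (by omega) (by omega) (by omega)
  have t1 : boxTime n b m < boxTime n a' n := by
    rw [boxTime_lt_iff] <;> omega
  have t2 : boxTime n a' n < boxTime n a d := by
    rw [boxTime_lt_iff] <;> omega
  rw [hY, R.state_chuteResult_mid X.supported (by omega) (by omega), Equiv.Perm.mul_apply, e2,
    ← hY] at e1
  have hk : northLabel n X.1 a' m = westLabel n X.1 b m :=
    R'.north_right.trans (R'.west_bot g2 le_rfl).symm
  have hl : northLabel n X.1 a' d = northLabel n X.1 (b + 1) m :=
    (R.north_mid ha.le g1.le f1 le_rfl).trans R.north_right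
  rw [← e1, ← hk, ← hl]
  by_cases hm : northLabel n X.1 a' y = northLabel n X.1 a' m
  · exact ⟨d, by omega, le_rfl, by rw [hm, Equiv.swap_apply_left]⟩
  by_cases hd : northLabel n X.1 a' y = northLabel n X.1 a' d
  · exact ⟨m, g2, f1.le, by rw [hd, Equiv.swap_apply_right]⟩
  · exact ⟨y, h1, h2, (Equiv.swap_apply_of_ne_of_ne hm hd).symm⟩

theorem phi_lt_of_side (R : IsChuteRect n X.1 a b m d) (hY : Y.1 = chuteResult X.1 a b m d)
    (R' : IsChuteRect n X.1 a' b c m) (hZ : Z.1 = chuteResult X.1 a' b c m) {r : RPD w}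
    (hr : chuteLE w X r) (hYr : PhiLE n Y.1 r.1) (hZr : PhiLE n Z.1 r.1) {y : ℕ} (h1 : m < y)
    (h2 : y ≤ d) :
    phi n X.1 (westLabel n X.1 b c) (northLabel n X.1 a y) <
      phi n r.1 (westLabel n X.1 b c) (northLabel n X.1 a y) := by
  have hs := X.supported
  have hx := X.reduced
  have ha := (R.side R').1
  have f1 := R.col_lt
  have f2 := R.le_bound
  have f3 := R.one_le_row
  have f4 := R.one_le_col
  have f5 := R.row_lt
  have g1 := R'.row_lt
  have g2 := R'.col_lt
  have g3 := R'.one_le_col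
  have hk : westLabel n X.1 b m = northLabel n X.1 (b + 1) c := R'.west_bot g2 le_rfl
  have hk' : northLabel n X.1 a' m = westLabel n X.1 b m := R'.north_right.trans hk.symm
  have hik : westLabel n X.1 b c < westLabel n X.1 b m := hk ▸ R'.left_lt_south hs hx
  have hkx := R.left_lt_top hs hx h1 h2
  have hw : westLabel n X.1 a' m = westLabel n X.1 b c := R'.west_top g2 le_rfl
  have hTik : theta n X.1 (westLabel n X.1 b c) (westLabel n X.1 b m) = a' :=
    hk' ▸ R'.theta_top hs hx g2 le_rfl
  have hTix : theta n X.1 (westLabel n X.1 b c) (northLabel n X.1 a y) = a' :=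
    hw ▸ R.theta_mid hs hx ha g1 h1 h2
  have hTkx := R.theta_top hs hx h1 h2
  have key : ∀ {e f g h : ℕ} (S : IsChuteRect n X.1 e f g h) (V : RPD w)
      (_ : V.1 = chuteResult X.1 e f g h) (_ : PhiLE n V.1 r.1) {u v : ℕ} (_ : u < v)
      (_ : (u, v) ∈ chuteBoxes n X.1 e f g h), phi n X.1 u v < phi n r.1 u v := by
    intro e f g h S V hV hVr u v huv hm
    have := hVr u v huv
    rw [phi_of_eq S hV huv, if_pos hm] at this
    omega
  refine lehmer_lt_of_lt (isBalancedColInj_theta hs hx)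
    (isBalancedColInj_theta r.supported r.reduced)
    (fun x y hxy => theta_eq_zero_iff_of_le hr hxy) (phiLE_of_le hr) (R'.one_le_left hs) hik hkx
    (hTik.trans hTix.symm) (by omega) (by omega) ?_ ?_
    (key R' Z hZ hZr hik (mem_chuteBoxes.2 ⟨rfl, m, g2, le_rfl, hk'⟩))
    (key R Y hY hYr hkx (mem_chuteBoxes.2 ⟨rfl, y, h1, h2, rfl⟩))
  · intro s h3 h4
    exact ⟨_, R.one_le_mid hs (r := s) (by omega) (by omega),
      R.mid_lt_left hs hx (by omega) (by omega), R.theta_mid hs hx (by omega) (by omega) h1 h2⟩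
  · intro h h3 h4 h5 h6
    rw [hTix] at h5 ⊢
    obtain ⟨z, hz⟩ := exists_crossAt_of_theta_ne_zero (n := n) (P := X.1)
      (x := westLabel n X.1 b c) (y := h) (by omega)
    rw [h5] at hz
    obtain ⟨e1, e2⟩ := hz.labels_eq hs hx h3
    obtain ⟨-, k1, k2, k3, -⟩ := hz
    have e3 : northLabel n X.1 a' z = h := (north_of_cross k2 k3).trans e2
    have hcz : c < z := by
      rcases lt_trichotomy z c with hzc | rfl | hzc
      · refine absurd ?_ (west_ne_south hs (r := a') (by omega) k1 hzc.le (by omega))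
        rw [e1, R'.north_col (by omega) (by omega)]
      · rw [R'.nw] at k3
        exact absurd k3 (by simp)
      · exact hzc
    rcases lt_trichotomy z m with hzm | rfl | hzm
    · have := R'.south_lt_top hs hx hcz hzm
      omega
    · omega
    rcases le_or_gt z d with hzd | hzd
    · have := R.left_lt_top hs hx hzm hzd
      rw [← R.north_mid ha.le g1.le hzm hzd] at this
      omega
    · have s1 := state_row_end hs (r := a') (c := z) (by omega) k1 (by omega)
      have s2 := state_row_end hs (r := a') (c := y) (by omega) (by omega) (by omega)
      rw [e3, ← Equiv.eq_symm_apply] at s1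
      rw [R.north_mid ha.le g1.le h1 h2, ← Equiv.eq_symm_apply] at s2
      obtain ⟨s, hst, hc⟩ := (state_symm_lt_iff ((reduced_iff_timeReduced hs).1 hx) (h4.trans hkx)
        (boxTime n a' n + 1)).1 (by omega)
      have := theta_row_le hs hx (Nat.lt_succ_iff.1 hst) hc
      rw [boxTime_div (by omega) le_rfl] at this
      omega

theorem exists_localJoin_of_side (R : IsChuteRect n X.1 a b m d)
    (hY : Y.1 = chuteResult X.1 a b m d) (R' : IsChuteRect n X.1 a' b c m)
    (hZ : Z.1 = chuteResult X.1 a' b c m) : ∃ W, LocalJoin X Y Z W := by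
  have hs := X.supported
  have hx := X.reduced
  obtain ⟨ha, S, S1, S2, he⟩ := R.side R'
  rw [← hY] at S he
  rw [← hZ] at S1 S2 he
  have f1 := R.col_lt
  have f2 := R.le_bound
  have f3 := R.one_le_row
  have f4 := R.one_le_col
  have f5 := R.row_lt
  have g1 := R'.row_lt
  have g2 := R'.col_lt
  have g3 := R'.one_le_col
  have hle : chuteLE w Z (Y.move S) :=
    (Z.le_move S1).tail ⟨_, _, _, _, S2, he⟩
  refine ⟨Y.move S, Y.le_move S, hle, fun r hr hYr hZr x y hxy => ?_⟩
  have hw : westLabel n Y.1 b c = westLabel n X.1 b c := by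
    rw [← state_west Y.supported (by omega) g3 (by omega),
      ← state_west hs (by omega) g3 (by omega), hY, R.state_chuteResult_le]
    refine le_of_lt ?_
    rw [boxTime_lt_iff] <;> omega
  rw [phi_of_eq S rfl hxy]
  split_ifs with hm
  · have hk : westLabel n X.1 b c < westLabel n X.1 b m := by
      rw [R'.west_bot g2 le_rfl]
      exact R'.left_lt_south hs hx
    obtain ⟨rfl, u, h1, h2, rfl⟩ := mem_chuteBoxes.1 hm
    rw [hw] at hxy ⊢
    obtain ⟨z, h3, h4, h5⟩ := exists_north_of_side R hY R' h1 h2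
    rw [← h5] at hxy ⊢
    rw [phi_of_eq R hY hxy, if_neg fun h => hk.ne (mem_chuteBoxes.1 h).1]
    rcases le_or_gt z m with hz | hz
    · have := hZr _ _ hxy
      rwa [phi_of_eq R' hZ hxy, if_pos (mem_chuteBoxes.2 ⟨rfl, z, h3, hz, rfl⟩)] at this
    · rw [R.north_mid ha.le g1.le hz h4]
      exact phi_lt_of_side R hY R' hZ hr hYr hZr hz h4
  · exact hYr x y hxy

/-- Any two distinct chute moves from `X` have a local join. -/
theorem exists_localJoin (hY : ChuteStep n X.1 Y.1) (hZ : ChuteStep n X.1 Z.1) (hne : Y ≠ Z) :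
    ∃ W, LocalJoin X Y Z W := by
  obtain ⟨a, b, c, d, R, hY⟩ := hY
  obtain ⟨a', b', c', d', R', hZ⟩ := hZ
  have hsw : (b, c) ≠ (b', c') := fun h => hne (eq_of_sw_eq R hY R' hZ h)
  rcases R.independent_or R' hsw with h | ⟨rfl, rfl⟩ | ⟨rfl, rfl⟩ | ⟨rfl, rfl⟩ | ⟨rfl, rfl⟩
  · have S : IsChuteRect n Z.1 a b c d := by
      rw [hZ]
      exact R.chuteResult_of_independent R' h
    exact ⟨Z.move S, localJoin_of_independent R hY R' hZ h rfl⟩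
  · exact exists_localJoin_of_stacked R hY R' hZ
  · exact (exists_localJoin_of_stacked R' hZ R hY).imp fun _ => LocalJoin.symm
  · exact exists_localJoin_of_side R hY R' hZ
  · exact (exists_localJoin_of_side R' hZ R hY).imp fun _ => LocalJoin.symm

/-- If `Y` is obtained from `X` by a chute move, then any pipe dream above `X` whose Lehmer tableau
is above that of `Y` is itself above `Y`. -/
theorem le_of_phiLE {r : RPD w} (hXr : chuteLE w X r) (h : ChuteStep n X.1 Y.1)
    (hYr : PhiLE n Y.1 r.1) : chuteLE w Y r := by
  induction hN : phiSum n r.1 - phiSum n X.1 using Nat.strong_induction_on generalizing X Y with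
  | _ N ih =>
  rcases hXr.cases_head with rfl | ⟨Z, hXZ, hZr⟩
  · exact absurd hYr (not_phiLE_of_step h)
  by_cases hne : Y = Z
  · exact hne ▸ hZr
  obtain ⟨W, hYW, hZW, hW⟩ := exists_localJoin h hXZ hne
  have hWr := hW r hXr hYr (phiLE_of_le hZr)
  suffices H : ∀ V, chuteLE w V W → phiSum n X.1 < phiSum n V.1 → chuteLE w V r →
      chuteLE w W r from hYW.trans (H Z hZW (phiSum_lt_of_step hXZ) hZr)
  intro V hVW
  induction hVW using Relation.ReflTransGen.head_induction_on with
  | refl => exact fun _ h => h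
  | @head V V' hVV' hV'W ih' =>
    intro h1 h2
    have h3 := phiSum_lt_of_step hVV'
    have hV'r := (phiLE_of_le hV'W).trans hWr
    have := hV'r.phiSum_le
    exact ih' (h1.trans h3) (ih _ (by omega) h2 hVV' hV'r rfl)

end RPD

namespace RPD

open PipeDream

variable {n : ℕ} {w : Equiv.Perm (Fin n)} {X Y Z W : RPD w} {a b c d a' b' c' d' : ℕ}

/-- Chute moves from `X` that increment a common box coincide. -/
theorem eq_of_mem_chuteBoxes (R : IsChuteRect n X.1 a b c d) (hY : Y.1 = chuteResult X.1 a b c d)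
    (R' : IsChuteRect n X.1 a' b' c' d') (hZ : Z.1 = chuteResult X.1 a' b' c' d') {p : ℕ × ℕ}
    (h : p ∈ chuteBoxes n X.1 a b c d) (h' : p ∈ chuteBoxes n X.1 a' b' c' d') : Y = Z := by
  by_contra hne
  exact Finset.disjoint_left.1 (R.disjoint_chuteBoxes X.supported X.reduced R'
    fun e => hne (eq_of_sw_eq R hY R' hZ e)) h h'

/-- If `X → Y` is a chute move, then it is the only chute move from `X` into `[X, Y]`. -/
theorem eq_of_step_of_le (hY : ChuteStep n X.1 Y.1) (hZ : ChuteStep n X.1 Z.1)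
    (hle : chuteLE w Z Y) : Z = Y := by
  obtain ⟨a, b, c, d, R, hY⟩ := hY
  obtain ⟨a', b', c', d', R', hZ⟩ := hZ
  have hm := mem_right R'
  have hlt := R'.lt_of_mem X.supported X.reduced hm
  have := phiLE_of_le hle _ _ hlt
  rw [phi_of_eq R' hZ hlt, phi_of_eq R hY hlt, if_pos hm] at this
  refine eq_of_mem_chuteBoxes R' hZ R hY hm ?_
  by_contra hn
  rw [if_neg hn] at this
  omega

theorem eq_of_le_of_le (h : chuteLE w X Y) (h' : chuteLE w Y X) : X = Y := by
  rcases h.cases_head with e | ⟨Z, hXZ, hZY⟩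
  · exact e
  · exact absurd (phiLE_of_le (hZY.trans h')) (not_phiLE_of_step hXZ)

theorem eq_or_eq_of_step (hXY : ChuteStep n X.1 Y.1) (h : chuteLE w X Z) (h' : chuteLE w Z Y) :
    Z = X ∨ Z = Y := by
  rcases h.cases_head with e | ⟨V, hXV, hVZ⟩
  · exact Or.inl e.symm
  · have := eq_of_step_of_le hXY hXV (hVZ.trans h')
    subst this
    exact Or.inr (eq_of_le_of_le h' hVZ)

theorem ne_of_step (h : ChuteStep n X.1 Y.1) : X ≠ Y := by
  rintro rfl
  exact lt_irrefl _ (phiSum_lt_of_step h)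

/-- A square of chute moves that contains every chute move from `X` into `[X, W]` is a
diamond. -/
theorem isPolygon_of_square (hXY : ChuteStep n X.1 Y.1) (hXZ : ChuteStep n X.1 Z.1)
    (hYW : ChuteStep n Y.1 W.1) (hZW : ChuteStep n Z.1 W.1) (hne : Y ≠ Z)
    (h : ∀ V : RPD w, ChuteStep n X.1 V.1 → chuteLE w V W → V = Y ∨ V = Z) :
    IsPolygon w X W ∧ (chuteIcc w X W).ncard = 4 := by
  have lXY : chuteLE w X Y := .single hXY
  have lXZ : chuteLE w X Z := .single hXZ
  have lYW : chuteLE w Y W := .single hYW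
  have lZW : chuteLE w Z W := .single hZW
  have lXW : chuteLE w X W := lXY.trans lYW
  have hXW : X ≠ W := by
    rintro rfl
    exact lt_asymm (phiSum_lt_of_step hXY) (phiSum_lt_of_step hYW)
  have hY := ne_of_step hXY
  have hZ := ne_of_step hXZ
  have hY' := ne_of_step hYW
  have hZ' := ne_of_step hZW
  have hIcc : chuteIcc w X W = {X, Y, Z, W} := by
    ext V
    simp only [chuteIcc, Set.mem_ofPred_eq, Set.mem_insert_iff, Set.mem_singleton_iff]
    constructor
    · rintro ⟨h1, h2⟩
      rcases h1.cases_head with e | ⟨U, hXU, hUV⟩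
      · exact Or.inl e.symm
      · rcases h U hXU (hUV.trans h2) with rfl | rfl
        · have := eq_or_eq_of_step hYW hUV h2
          tauto
        · have := eq_or_eq_of_step hZW hUV h2
          tauto
    · rintro (rfl | rfl | rfl | rfl)
      · exact ⟨.refl, lXW⟩
      · exact ⟨lXY, lYW⟩
      · exact ⟨lXZ, lZW⟩
      · exact ⟨lXW, .refl⟩
  have hcard : (chuteIcc w X W).ncard = 4 := by
    rw [hIcc, Set.ncard_insert_of_notMem (by simp [hY, hZ, hXW]),
      Set.ncard_insert_of_notMem (by simp [hne, hY']), Set.ncard_pair hZ']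
  have hchain : ∀ V : RPD w, chuteLE w X V → chuteLE w V W → chuteChain w {X, V, W} := by
    intro V h1 h2
    rintro x (rfl | rfl | rfl) y (rfl | rfl | rfl) <;>
      first
      | exact Or.inl .refl
      | exact Or.inl ‹_›
      | exact Or.inr ‹_›
  refine ⟨⟨lXW, hcard.ge, {X, Y, W}, {X, Z, W}, hchain Y lXY lYW, hchain Z lXZ lZW, ?_, ?_⟩, hcard⟩
  · rw [hIcc]
    ext V
    simp only [Set.mem_union, Set.mem_insert_iff, Set.mem_singleton_iff]
    tauto
  · ext V
    simp only [Set.mem_inter_iff, Set.mem_insert_iff, Set.mem_singleton_iff]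
    constructor
    · rintro ⟨rfl | rfl | rfl, h2⟩ <;> tauto
    · tauto

/-- The join of two independent chute moves. -/
theorem isJoinOf_of_independent (R : IsChuteRect n X.1 a b c d)
    (hY : Y.1 = chuteResult X.1 a b c d) (R' : IsChuteRect n X.1 a' b' c' d')
    (hZ : Z.1 = chuteResult X.1 a' b' c' d')
    (hi : IsChuteRect.Independent a b c d a' b' c' d') (hW : W.1 = chuteResult Z.1 a b c d)
    (hYW : ChuteStep n Y.1 W.1) : IsJoinOf w W Y Z := by
  obtain ⟨h1, h2, h3⟩ := localJoin_of_independent R hY R' hZ hi hW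
  have lXY : chuteLE w X Y := .single ⟨_, _, _, _, R, hY⟩
  exact ⟨h1, h2, fun r hYr hZr =>
    le_of_phiLE hYr hYW (h3 r (lXY.trans hYr) (phiLE_of_le hYr) (phiLE_of_le hZr))⟩

end RPD

/-- two chute moves applied to `P₀` whose rectangles `R₁, R₂` are such
that `SW(R₁)` is not a corner of `R₂` and `SW(R₂)` is not a corner of `R₁` commute;
their common result is the join `P₁ ∨ P₂`, whose Lehmer tableau is the componentwise
maximum of `Φ(P₁)` and `Φ(P₂)`, and the interval `[P₀, P₁ ∨ P₂]` is a diamond. -/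
theorem commuting_chute_moves {n : ℕ} (w : Equiv.Perm (Fin n))
    (P₀ P₁ P₂ : RPD w) (a₁ b₁ c₁ d₁ a₂ b₂ c₂ d₂ : ℕ)
    (h₁ : IsChuteRect n P₀.1 a₁ b₁ c₁ d₁) (hP₁ : P₁.1 = chuteResult P₀.1 a₁ b₁ c₁ d₁)
    (h₂ : IsChuteRect n P₀.1 a₂ b₂ c₂ d₂) (hP₂ : P₂.1 = chuteResult P₀.1 a₂ b₂ c₂ d₂)
    (hd₁ : P₀ ≠ P₁) (hd₂ : P₀ ≠ P₂) (hd₃ : P₁ ≠ P₂)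
    (hc₁ : (b₁, c₁) ≠ (a₂, c₂) ∧ (b₁, c₁) ≠ (a₂, d₂) ∧
           (b₁, c₁) ≠ (b₂, c₂) ∧ (b₁, c₁) ≠ (b₂, d₂))
    (hc₂ : (b₂, c₂) ≠ (a₁, c₁) ∧ (b₂, c₂) ≠ (a₁, d₁) ∧
           (b₂, c₂) ≠ (b₁, c₁) ∧ (b₂, c₂) ≠ (b₁, d₁)) :
    IsChuteRect n P₂.1 a₁ b₁ c₁ d₁ ∧ IsChuteRect n P₁.1 a₂ b₂ c₂ d₂ ∧
      chuteResult P₂.1 a₁ b₁ c₁ d₁ = chuteResult P₁.1 a₂ b₂ c₂ d₂ ∧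
      ∃ P₃ : RPD w, P₃.1 = chuteResult P₂.1 a₁ b₁ c₁ d₁ ∧
        IsJoinOf w P₃ P₁ P₂ ∧
        (∀ i j, IsInv w i j →
          phi n P₃.1 i j = max (phi n P₁.1 i j) (phi n P₂.1 i j)) ∧
        IsPolygon w P₀ P₃ ∧ (chuteIcc w P₀ P₃).ncard = 4 := by
  have hi : IsChuteRect.Independent a₁ b₁ c₁ d₁ a₂ b₂ c₂ d₂ := ⟨hc₁, hc₂⟩
  have S₁ : IsChuteRect n P₂.1 a₁ b₁ c₁ d₁ := by
    rw [hP₂]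
    exact h₁.chuteResult_of_independent h₂ hi
  have S₂ : IsChuteRect n P₁.1 a₂ b₂ c₂ d₂ := by
    rw [hP₁]
    exact h₂.chuteResult_of_independent h₁ hi.symm
  have hcomm : chuteResult P₂.1 a₁ b₁ c₁ d₁ = chuteResult P₁.1 a₂ b₂ c₂ d₂ := by
    rw [hP₁, hP₂, IsChuteRect.chuteResult_comm hi]
  have hstep : ChuteStep n P₁.1 (P₂.move S₁).1 := ⟨_, _, _, _, S₂, hcomm⟩
  have hphi : ∀ {x y : ℕ}, x < y → phi n (P₂.move S₁).1 x y = phi n P₀.1 x y +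
      (if (x, y) ∈ chuteBoxes n P₀.1 a₁ b₁ c₁ d₁ then 1 else 0) +
        if (x, y) ∈ chuteBoxes n P₀.1 a₂ b₂ c₂ d₂ then 1 else 0 :=
    RPD.phi_square h₁ hP₁ h₂ hP₂ hi.1.2.2.1 S₂ hcomm rfl (RPD.phiLE_of_le (P₂.le_move S₁))
  refine ⟨S₁, S₂, hcomm, P₂.move S₁, rfl,
    RPD.isJoinOf_of_independent h₁ hP₁ h₂ hP₂ hi rfl hstep, fun i j hij => ?_,
    RPD.isPolygon_of_square ⟨_, _, _, _, h₁, hP₁⟩ ⟨_, _, _, _, h₂, hP₂⟩ hstep (P₂.step_move S₁)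
      hd₃ fun V hV hle => ?_⟩
  · have hd := h₁.disjoint_chuteBoxes P₀.supported P₀.reduced h₂ hi.1.2.2.1
    rw [hphi hij.2.1, RPD.phi_of_eq h₁ hP₁ hij.2.1, RPD.phi_of_eq h₂ hP₂ hij.2.1]
    by_cases hb : (i, j) ∈ chuteBoxes n P₀.1 a₁ b₁ c₁ d₁
    · simp [hb, Finset.disjoint_left.1 hd hb]
    · simp [hb]
  · obtain ⟨a, b, c, d, R, hV⟩ := hV
    have hm := RPD.mem_right R
    have hlt := R.lt_of_mem P₀.supported P₀.reduced hm
    have hle := RPD.phiLE_of_le hle _ _ hlt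
    rw [RPD.phi_of_eq R hV hlt, hphi hlt, if_pos hm] at hle
    by_cases hb : (westLabel n P₀.1 b c, northLabel n P₀.1 a d) ∈ chuteBoxes n P₀.1 a₁ b₁ c₁ d₁
    · exact Or.inl (RPD.eq_of_mem_chuteBoxes R hV h₁ hP₁ hm hb)
    · refine Or.inr (RPD.eq_of_mem_chuteBoxes R hV h₂ hP₂ hm ?_)
      by_contra hb'
      rw [if_neg hb, if_neg hb'] at hle
      omega
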